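/- arXiv:1905.12782 — 11 statements merged into one kernel-verified Lean document; each statement's English description precedes it below -/
import Mathlib

section
/- Let ℒ be a finite labeled set in ℝ×{−1,+1} with distinct first coordinates whose two smallest labeled points carry equal labels and whose two largest labeled points carry equal labels. Let x₁ < x₂ be two consecutive labeled points of ℒ (no labeled point strictly between them), both lying strictly between the outermost labeled points, with opposite labels y₁ ≠ y₂. Then for every u with x₁ < u < x₂, the function-norm score satisfies score_F((x₁+x₂)/2) ≥ score_F(u). -/
open Matrix MeasureTheory

/-- A two-layer ReLU network with `N` hidden units: `x ↦ ∑ n, v n * max 0 (u n * x + b n) + c`. -/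
noncomputable def reluNet (N : ℕ) (v u b : Fin N → ℝ) (c : ℝ) : ℝ → ℝ :=
  fun x => (∑ n, v n * max 0 (u n * x + b n)) + c

/-- The Euclidean norm of the weight vector `w = (v, u)` of a two-layer ReLU network. -/
noncomputable def weightNorm (N : ℕ) (v u : Fin N → ℝ) : ℝ :=
  Real.sqrt ((∑ n, (v n) ^ 2) + (∑ n, (u n) ^ 2))

/-- The minimum interpolation "norm" `m(ℒ)` of a finite labeled set `ℒ`. -/
noncomputable def interpNorm (L : Finset (ℝ × ℝ)) : ℝ :=
  sInf {t : ℝ | ∃ (N : ℕ) (v u b : Fin N → ℝ) (c : ℝ),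
    (∀ q ∈ L, reluNet N v u b c q.1 = q.2) ∧ t = weightNorm N v u}

/-- The function-norm score: `score_F(x) = min (m(ℒ ∪ {(x,+1)}), m(ℒ ∪ {(x,−1)}))`. -/
noncomputable def scoreF (L : Finset (ℝ × ℝ)) (x : ℝ) : ℝ :=
  min (interpNorm (insert (x, 1) L)) (interpNorm (insert (x, -1) L))

/-- The labeled points have distinct first coordinates. -/
def distinctX (L : Finset (ℝ × ℝ)) : Prop := ∀ p ∈ L, ∀ q ∈ L, p.1 = q.1 → p = q

/-- All labels are in {−1, +1}. -/
def labelsPM (L : Finset (ℝ × ℝ)) : Prop := ∀ p ∈ L, p.2 = 1 ∨ p.2 = -1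

/-- The two smallest labeled points carry equal labels. -/
def twoSmallestEqual (L : Finset (ℝ × ℝ)) : Prop :=
  ∃ p ∈ L, ∃ q ∈ L, p.1 < q.1 ∧ (∀ r ∈ L, r ≠ p → r ≠ q → q.1 < r.1) ∧ p.2 = q.2

/-- The two largest labeled points carry equal labels. -/
def twoLargestEqual (L : Finset (ℝ × ℝ)) : Prop :=
  ∃ p ∈ L, ∃ q ∈ L, q.1 < p.1 ∧ (∀ r ∈ L, r ≠ p → r ≠ q → r.1 < q.1) ∧ p.2 = q.2

/-- The point lies strictly between the outermost labeled points of `L`. -/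
def strictlyInterior (L : Finset (ℝ × ℝ)) (t : ℝ) : Prop :=
  (∃ a ∈ L, a.1 < t) ∧ (∃ b ∈ L, t < b.1)

/-- The slope of the chord of `g` over `[p, q]`. -/
noncomputable def chordSlope (g : ℝ → ℝ) (p q : ℝ) : ℝ := (g q - g p) / (q - p)

/-- The total variation of the chord slopes of `g` along a list of abscissas. -/
noncomputable def slopeVariation (g : ℝ → ℝ) : List ℝ → ℝ
  | p :: q :: r :: l =>
      |chordSlope g q r - chordSlope g p q| + slopeVariation g (q :: r :: l)
  | _ => 0

lemma slopeVariation_congr {f g : ℝ → ℝ} :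
    ∀ l : List ℝ, (∀ x ∈ l, f x = g x) → slopeVariation f l = slopeVariation g l
  | [], _ => by simp [slopeVariation]
  | [_], _ => by simp [slopeVariation]
  | [_, _], _ => by simp [slopeVariation]
  | p :: q :: r :: l, h => by
      have ih := slopeVariation_congr (q :: r :: l) fun x hx => h x (List.mem_cons_of_mem _ hx)
      simp only [slopeVariation, chordSlope, ih, h p (by simp), h q (by simp), h r (by simp)]

lemma slopeVariation_append (g : ℝ → ℝ) (p q : ℝ) (R : List ℝ) : ∀ A : List ℝ,
    slopeVariation g (A ++ p :: q :: R) =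
      slopeVariation g (A ++ [p, q]) + slopeVariation g (p :: q :: R)
  | [] => by simp [slopeVariation]
  | [a] => by simp [slopeVariation]
  | [a, b] => by simp [slopeVariation, add_assoc]
  | a :: b :: c :: A => by
      have ih := slopeVariation_append g p q R (b :: c :: A)
      simp only [List.cons_append, slopeVariation] at ih ⊢
      rw [ih, add_assoc]

lemma slopeVariation_sum_le {N : ℕ} (v : Fin N → ℝ) (φ : Fin N → ℝ → ℝ) (c : ℝ) :
    ∀ l : List ℝ, slopeVariation (fun x => (∑ n, v n * φ n x) + c) l ≤
      ∑ n, |v n| * slopeVariation (φ n) l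
  | [] => by simp [slopeVariation]
  | [_] => by simp [slopeVariation]
  | [_, _] => by simp [slopeVariation]
  | p :: q :: r :: l => by
      have ih := slopeVariation_sum_le v φ c (q :: r :: l)
      have hs : ∀ a b : ℝ, chordSlope (fun x => (∑ n, v n * φ n x) + c) a b =
          ∑ n, v n * chordSlope (φ n) a b := by
        intro a b
        simp only [chordSlope, add_sub_add_right_eq_sub, ← Finset.sum_sub_distrib,
          Finset.sum_div]
        exact Finset.sum_congr rfl fun n _ => by ring
      simp only [slopeVariation, mul_add, Finset.sum_add_distrib]
      refine add_le_add ?_ ih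
      rw [hs, hs, ← Finset.sum_sub_distrib]
      refine (Finset.abs_sum_le_sum_abs _ _).trans (le_of_eq ?_)
      exact Finset.sum_congr rfl fun n _ => by rw [← mul_sub, abs_mul]

lemma ConvexOn.slopeVariation_le {φ : ℝ → ℝ} (hφ : ConvexOn ℝ Set.univ φ) {M : ℝ}
    (hM : ∀ p q, p < q → chordSlope φ p q ≤ M) : ∀ (l : List ℝ) (p q : ℝ),
    (p :: q :: l).Pairwise (· < ·) → slopeVariation φ (p :: q :: l) ≤ M - chordSlope φ p q
  | [], p, q, h => by
      have := hM p q (by simpa using h)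
      simp only [slopeVariation]
      linarith
  | r :: l, p, q, h => by
      have hpq : p < q := (List.pairwise_cons.1 h).1 q (by simp)
      have hqr : q < r := (List.pairwise_cons.1 (List.pairwise_cons.1 h).2).1 r (by simp)
      have ih := hφ.slopeVariation_le hM l q r (List.pairwise_cons.1 h).2
      have hmono : chordSlope φ p q ≤ chordSlope φ q r :=
        hφ.slope_mono_adjacent (Set.mem_univ _) (Set.mem_univ _) hpq hqr
      simp only [slopeVariation]
      rw [abs_of_nonneg (by linarith)]
      linarith

lemma convexOn_reluUnit (u b : ℝ) : ConvexOn ℝ Set.univ fun x : ℝ => max 0 (u * x + b) := by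
  refine (convexOn_const 0 convex_univ).sup ⟨convex_univ, ?_⟩
  intro x _ y _ s t _ _ hst
  simp only [smul_eq_mul]
  refine le_of_eq ?_
  linear_combination -b * hst

lemma slopeVariation_reluUnit_le (u b : ℝ) (l : List ℝ) (hl : l.Pairwise (· < ·)) :
    slopeVariation (fun x => max 0 (u * x + b)) l ≤ |u| := by
  have hle : ∀ p q : ℝ, p < q →
      chordSlope (fun x => max 0 (u * x + b)) p q ≤ max u 0 ∧
      min u 0 ≤ chordSlope (fun x => max 0 (u * x + b)) p q := by
    intro p q hpq
    have hd : 0 < q - p := sub_pos.2 hpq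
    simp only [chordSlope]
    rw [div_le_iff₀ hd, le_div_iff₀ hd]
    rcases le_total u 0 with hu | hu
    · have := mul_nonneg_of_nonpos_of_nonpos hu (by linarith : p - q ≤ 0)
      rw [max_eq_right hu, min_eq_left hu]
      rcases max_cases 0 (u * p + b) with h | h <;> rcases max_cases 0 (u * q + b) with h' | h' <;>
        constructor <;> nlinarith
    · have := mul_nonneg hu hd.le
      rw [max_eq_left hu, min_eq_right hu]
      rcases max_cases 0 (u * p + b) with h | h <;> rcases max_cases 0 (u * q + b) with h' | h' <;>
        constructor <;> nlinarith
  match l, hl with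
  | [], _ => simp [slopeVariation]
  | [_], _ => simp [slopeVariation]
  | p :: q :: l, hl =>
    have h1 := (convexOn_reluUnit u b).slopeVariation_le (fun p q h => (hle p q h).1) l p q hl
    have h2 := (hle p q ((List.pairwise_cons.1 hl).1 q (by simp))).2
    have h3 : max u 0 - min u 0 = |u| := by
      rcases le_total u 0 with hu | hu <;> simp [hu, abs_of_nonneg, abs_of_nonpos]
    linarith

lemma slopeVariation_reluNet_le (N : ℕ) (v u b : Fin N → ℝ) (c : ℝ) (l : List ℝ)
    (hl : l.Pairwise (· < ·)) :
    √(2 * slopeVariation (reluNet N v u b c) l) ≤ weightNorm N v u := by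
  refine Real.sqrt_le_sqrt ?_
  have h1 := slopeVariation_sum_le v (fun n x => max 0 (u n * x + b n)) c l
  have h2 : ∑ n, |v n| * slopeVariation (fun x => max 0 (u n * x + b n)) l ≤
      ∑ n, |v n| * |u n| :=
    Finset.sum_le_sum fun n _ =>
      mul_le_mul_of_nonneg_left (slopeVariation_reluUnit_le _ _ l hl) (abs_nonneg _)
  have h3 : ∑ n, 2 * (|v n| * |u n|) ≤ ∑ n, (v n ^ 2 + u n ^ 2) :=
    Finset.sum_le_sum fun n _ => by
      nlinarith [sq_nonneg (|v n| - |u n|), sq_abs (v n), sq_abs (u n)]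
  rw [← Finset.mul_sum, Finset.sum_add_distrib] at h3
  unfold reluNet
  linarith

/-- The piecewise linear interpolant of `g` as an affine function plus hinges, the total weight
of which is the slope variation. -/
lemma exists_hinge_interpolation (g : ℝ → ℝ) : ∀ (l : List ℝ) (p q : ℝ),
    (p :: q :: l).Pairwise (· < ·) → ∃ (N : ℕ) (J T : Fin N → ℝ), (∀ n, q ≤ T n) ∧
      ∑ n, |J n| = slopeVariation g (p :: q :: l) ∧
      ∀ x ∈ p :: q :: l,
        g p + chordSlope g p q * (x - p) + ∑ n, J n * max 0 (x - T n) = g x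
  | [], p, q, h => by
      have hpq : p < q := (List.pairwise_cons.1 h).1 q (by simp)
      refine ⟨0, Fin.elim0, Fin.elim0, fun n => n.elim0, by simp [slopeVariation], ?_⟩
      have : q - p ≠ 0 := (sub_pos.2 hpq).ne'
      intro x hx
      simp only [List.mem_cons, List.not_mem_nil, or_false] at hx
      rcases hx with rfl | rfl
      · simp
      · simp [chordSlope, this]
  | r :: l, p, q, h => by
      have h' := (List.pairwise_cons.1 h).2
      have hpq : p < q := (List.pairwise_cons.1 h).1 q (by simp)
      have hqr : q < r := (List.pairwise_cons.1 h').1 r (by simp)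
      obtain ⟨N, J, T, hT, hJ, hx⟩ := exists_hinge_interpolation g l q r h'
      refine ⟨N + 1, Fin.cons (chordSlope g q r - chordSlope g p q) J, Fin.cons q T, ?_, ?_, ?_⟩
      · intro n
        refine Fin.cases ?_ (fun n => ?_) n
        · simp
        · simpa using hqr.le.trans (hT n)
      · simp [Fin.sum_univ_succ, hJ, slopeVariation]
      · intro x hxm
        rw [Fin.sum_univ_succ]
        simp only [Fin.cons_zero, Fin.cons_succ]
        rcases List.mem_cons.1 hxm with rfl | hxm
        · have : ∑ n, J n * max 0 (x - T n) = 0 :=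
            Finset.sum_eq_zero fun n _ => by
              rw [max_eq_left (by linarith [hT n]), mul_zero]
          rw [this, max_eq_left (by linarith)]
          ring
        · have hqx : q ≤ x := by
            rcases List.mem_cons.1 hxm with rfl | hxm
            · exact le_rfl
            · exact ((List.pairwise_cons.1 h').1 x hxm).le
          rw [← hx x hxm, max_eq_right (by linarith)]
          have : chordSlope g p q * (q - p) = g q - g p :=
            div_mul_cancel₀ _ (sub_pos.2 hpq).ne'
          linear_combination this

/-- If the first two labels agree, the minimum interpolation norm is determined by the slope
variation of the piecewise linear interpolant. -/
lemma interpNorm_eq_sqrt_slopeVariation (M : Finset (ℝ × ℝ)) (g : ℝ → ℝ) (p q : ℝ) (l : List ℝ)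
    (hl : (p :: q :: l).Pairwise (· < ·)) (hpq : g p = g q)
    (hmem : ∀ x, x ∈ p :: q :: l ↔ ∃ r ∈ M, r.1 = x) (hg : ∀ r ∈ M, g r.1 = r.2) :
    interpNorm M = √(2 * slopeVariation g (p :: q :: l)) := by
  refine IsLeast.csInf_eq ⟨?_, ?_⟩
  · obtain ⟨N, J, T, -, hJ, hx⟩ := exists_hinge_interpolation g l p q hl
    refine ⟨N, fun n => SignType.sign (J n) * √|J n|, fun n => √|J n|,
      fun n => -(√|J n| * T n), g p, ?_, ?_⟩
    · intro r hr
      rw [← hg r hr, ← hx r.1 ((hmem _).2 ⟨r, hr, rfl⟩)]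
      simp only [reluNet, chordSlope, hpq, sub_self, zero_div, zero_mul, add_zero]
      rw [add_comm]
      congr 1
      refine Finset.sum_congr rfl fun n _ => ?_
      have h1 : √|J n| * r.1 + -(√|J n| * T n) = √|J n| * (r.1 - T n) := by ring
      have h2 : max 0 (√|J n| * (r.1 - T n)) = √|J n| * max 0 (r.1 - T n) := by
        rw [mul_max_of_nonneg _ _ (Real.sqrt_nonneg _), mul_zero]
      rw [h1, h2]
      have h3 : √|J n| * √|J n| = |J n| := Real.mul_self_sqrt (abs_nonneg _)
      have h4 : (SignType.sign (J n) : ℝ) * |J n| = J n := sign_mul_abs _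
      linear_combination
        (SignType.sign (J n) : ℝ) * max 0 (r.1 - T n) * h3 + max 0 (r.1 - T n) * h4
    · unfold weightNorm
      rw [← hJ, two_mul]
      congr 2
      · refine Finset.sum_congr rfl fun n _ => ?_
        rw [mul_pow, Real.sq_sqrt (abs_nonneg _)]
        rcases lt_trichotomy (J n) 0 with h | h | h <;> simp [h]
      · exact Finset.sum_congr rfl fun n _ => (Real.sq_sqrt (abs_nonneg _)).symm
  · rintro t ⟨N, v, u, b, c, hi, rfl⟩
    rw [← slopeVariation_congr (f := reluNet N v u b c)]
    · exact slopeVariation_reluNet_le N v u b c _ hl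
    · intro x hx
      obtain ⟨r, hr, rfl⟩ := (hmem x).1 hx
      rw [hi r hr, hg r hr]

/-- Slope variation across an inserted point carrying the label of one of its neighbours, when
the two neighbours carry opposite labels. -/
lemma slopeVariation_insert (g : ℝ → ℝ) {p x₁ u x₂ c : ℝ} (hp : p < x₁) (hu₁ : x₁ < u)
    (hu₂ : u < x₂) (hc : x₂ < c) (hgp : g p = 1 ∨ g p = -1) (hgc : g c = 1 ∨ g c = -1)
    (hg₁ : g x₁ = 1 ∨ g x₁ = -1) (hg₂ : g x₂ = -g x₁) (A B : List ℝ) :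
    (g u = g x₁ → slopeVariation g (A ++ p :: x₁ :: u :: x₂ :: c :: B) =
      slopeVariation g (A ++ [p, x₁]) + slopeVariation g (x₂ :: c :: B) +
        |chordSlope g p x₁| + |chordSlope g x₂ c| + 4 / (x₂ - u)) ∧
    (g u = -g x₁ → slopeVariation g (A ++ p :: x₁ :: u :: x₂ :: c :: B) =
      slopeVariation g (A ++ [p, x₁]) + slopeVariation g (x₂ :: c :: B) +
        |chordSlope g p x₁| + |chordSlope g x₂ c| + 4 / (u - x₁)) := by
  have e₁ : 0 < 2 / (u - x₁) := div_pos two_pos (sub_pos.2 hu₁)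
  have e₂ : 0 < 2 / (x₂ - u) := div_pos two_pos (sub_pos.2 hu₂)
  have hs : 0 ≤ g x₁ * chordSlope g p x₁ := by
    rw [chordSlope, ← mul_div_assoc]
    refine div_nonneg ?_ (sub_pos.2 hp).le
    rcases hg₁ with h | h <;> rcases hgp with h' | h' <;> norm_num [h, h']
  have ht : 0 ≤ g x₁ * chordSlope g x₂ c := by
    rw [chordSlope, ← mul_div_assoc, hg₂]
    refine div_nonneg ?_ (sub_pos.2 hc).le
    rcases hg₁ with h | h <;> rcases hgc with h' | h' <;> norm_num [h, h']
  have four : ∀ a : ℝ, 4 / a = 2 / a + 2 / a := fun a => by ring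
  rw [slopeVariation_append]
  simp only [slopeVariation, four]
  generalize chordSlope g p x₁ = s at *
  generalize chordSlope g x₂ c = t at *
  constructor <;> intro hgu
  · have h₁ : chordSlope g x₁ u = 0 := by simp [chordSlope, hgu]
    have h₂ : chordSlope g u x₂ = -g x₁ * (2 / (x₂ - u)) := by
      rw [chordSlope, hgu, hg₂]; ring
    rw [h₁, h₂, zero_sub, sub_zero, abs_neg]
    generalize 2 / (x₂ - u) = d at *
    rcases hg₁ with h | h <;> rw [h] at hs ht ⊢
    · rw [abs_of_nonpos (by linarith : -1 * d ≤ 0), abs_of_nonneg (by linarith : 0 ≤ t - -1 * d),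
        abs_of_nonneg (by linarith : 0 ≤ t)]
      ring
    · rw [abs_of_nonneg (by linarith : 0 ≤ - -1 * d),
        abs_of_nonpos (by linarith : t - - -1 * d ≤ 0), abs_of_nonpos (by linarith : t ≤ 0)]
      ring
  · have h₁ : chordSlope g u x₂ = 0 := by simp [chordSlope, hgu, hg₂]
    have h₂ : chordSlope g x₁ u = -g x₁ * (2 / (u - x₁)) := by
      rw [chordSlope, hgu]; ring
    rw [h₁, h₂, zero_sub, sub_zero, abs_neg]
    generalize 2 / (u - x₁) = d at *
    rcases hg₁ with h | h <;> rw [h] at hs ht ⊢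
    · rw [abs_of_nonpos (by linarith : -1 * d ≤ 0), abs_of_nonpos (by linarith : -1 * d - s ≤ 0),
        abs_of_nonneg (by linarith : 0 ≤ s)]
      ring
    · rw [abs_of_nonneg (by linarith : 0 ≤ - -1 * d),
        abs_of_nonneg (by linarith : 0 ≤ - -1 * d - s), abs_of_nonpos (by linarith : s ≤ 0)]
      ring

/-- The two smallest entries of an increasing list are its first two entries. -/
lemma eq_head_of_pairwise_lt {l : List ℝ} {a b p q : ℝ} (hl : (a :: b :: l).Pairwise (· < ·))
    (hp : p ∈ a :: b :: l) (hq : q ∈ a :: b :: l) (hpq : p < q)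
    (ha : a = p ∨ a = q ∨ q < a) (hb : b = p ∨ b = q ∨ q < b) : a = p ∧ b = q := by
  obtain ⟨hal, hl'⟩ := List.pairwise_cons.1 hl
  have hbl := (List.pairwise_cons.1 hl').1
  have hab : a < b := hal b (by simp)
  have hap : a ≤ p := by
    rcases List.mem_cons.1 hp with rfl | h
    · exact le_rfl
    · exact (hal _ h).le
  have hap' : a = p := by rcases ha with h | h | h <;> linarith
  have hbq : b ≤ q := by
    rcases List.mem_cons.1 hq with rfl | h
    · linarith
    · rcases List.mem_cons.1 h with rfl | h
      · exact le_rfl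
      · exact (hbl _ h).le
  refine ⟨hap', ?_⟩
  rcases hb with h | h | h <;> linarith

/-- Inside a gap between consecutive oppositely labeled points, both one-point extensions have an
explicit minimum norm, up to a constant not depending on the inserted point. -/
lemma exists_interpNorm_insert_eq (L : Finset (ℝ × ℝ))
    (hdx : distinctX L) (hlab : labelsPM L) (hsmall : twoSmallestEqual L) (x₁ x₂ y : ℝ)
    (h₁ : (x₁, y) ∈ L) (h₂ : (x₂, -y) ∈ L)
    (hcons : ∀ r ∈ L, ¬(x₁ < r.1 ∧ r.1 < x₂))
    (hint₁ : strictlyInterior L x₁) (hint₂ : strictlyInterior L x₂) :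
    ∃ C : ℝ, ∀ u, x₁ < u → u < x₂ →
      interpNorm (insert (u, y) L) = √(2 * (C + 4 / (x₂ - u))) ∧
      interpNorm (insert (u, -y) L) = √(2 * (C + 4 / (u - x₁))) := by
  classical
  obtain ⟨g, hg⟩ : ∃ g : ℝ → ℝ, ∀ r ∈ L, g r.1 = r.2 := by
    refine ⟨fun x => if h : ∃ r ∈ L, r.1 = x then h.choose.2 else 0, fun r hr => ?_⟩
    have h : ∃ r' ∈ L, r'.1 = r.1 := ⟨r, hr, rfl⟩
    simp only [dif_pos h]
    rw [hdx _ h.choose_spec.1 _ hr h.choose_spec.2]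
  set S := L.image Prod.fst with hS
  have hSmem : ∀ x, x ∈ S ↔ ∃ r ∈ L, r.1 = x := by simp [hS]
  have hSlab : ∀ x ∈ S, g x = 1 ∨ g x = -1 := by
    intro x hx
    obtain ⟨r, hr, rfl⟩ := (hSmem x).1 hx
    rw [hg r hr]
    exact hlab r hr
  obtain ⟨A, hA, hAs⟩ : ∃ A : List ℝ, (∀ x, x ∈ A ↔ x ∈ S ∧ x < x₁) ∧ A.Pairwise (· < ·) :=
    ⟨(S.filter (· < x₁)).sort (· ≤ ·), fun x => by simp, Finset.sortedLT_sort _ |>.pairwise⟩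
  obtain ⟨B, hB, hBs⟩ : ∃ B : List ℝ, (∀ x, x ∈ B ↔ x ∈ S ∧ x₂ < x) ∧ B.Pairwise (· < ·) :=
    ⟨(S.filter (x₂ < ·)).sort (· ≤ ·), fun x => by simp, Finset.sortedLT_sort _ |>.pairwise⟩
  have hx₁S : x₁ ∈ S := (hSmem _).2 ⟨_, h₁, rfl⟩
  have hx₂S : x₂ ∈ S := (hSmem _).2 ⟨_, h₂, rfl⟩
  have hgx₁ : g x₁ = y := hg _ h₁
  have hgx₂ : g x₂ = -y := hg _ h₂
  obtain ⟨A, p, rfl⟩ : ∃ A' p, A = A' ++ [p] := by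
    rcases List.eq_nil_or_concat A with rfl | ⟨A', p, h⟩
    · obtain ⟨a, ha, hlt⟩ := hint₁.1
      simpa using (hA a.1).2 ⟨(hSmem _).2 ⟨a, ha, rfl⟩, hlt⟩
    · exact ⟨A', p, by simpa using h⟩
  obtain ⟨c, B, rfl⟩ : ∃ c B', B = c :: B' := by
    rcases B with _ | ⟨c, B'⟩
    · obtain ⟨a, ha, hlt⟩ := hint₂.2
      simpa using (hB a.1).2 ⟨(hSmem _).2 ⟨a, ha, rfl⟩, hlt⟩
    · exact ⟨c, B', rfl⟩
  have hp := (hA p).1 (by simp)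
  have hc := (hB c).1 (by simp)
  refine ⟨slopeVariation g (A ++ [p, x₁]) + slopeVariation g (x₂ :: c :: B) +
    |chordSlope g p x₁| + |chordSlope g x₂ c|, fun u hu₁ hu₂ => ?_⟩
  have huS : u ∉ S := fun h => by
    obtain ⟨r, hr, rfl⟩ := (hSmem u).1 h
    exact hcons r hr ⟨hu₁, hu₂⟩
  have hmemS : ∀ x, x ∈ A ++ p :: x₁ :: u :: x₂ :: c :: B ↔ x = u ∨ x ∈ S := by
    intro x
    have h1 : x ∈ A ++ p :: x₁ :: u :: x₂ :: c :: B ↔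
        x ∈ A ++ [p] ∨ x = x₁ ∨ x = u ∨ x = x₂ ∨ x ∈ c :: B := by
      simp [or_assoc]
    rw [h1, hA, hB]
    constructor
    · rintro (h | rfl | h | rfl | h)
      exacts [.inr h.1, .inr hx₁S, .inl h, .inr hx₂S, .inr h.1]
    · rintro (h | h)
      · exact .inr (.inr (.inl h))
      · rcases lt_trichotomy x x₁ with h' | h' | h'
        · exact .inl ⟨h, h'⟩
        · exact .inr (.inl h')
        · rcases lt_trichotomy x x₂ with h'' | h'' | h''
          · obtain ⟨r, hr, rfl⟩ := (hSmem x).1 h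
            exact absurd ⟨h', h''⟩ (hcons r hr)
          · exact .inr (.inr (.inr (.inl h'')))
          · exact .inr (.inr (.inr (.inr ⟨h, h''⟩)))
  have hsorted : (A ++ p :: x₁ :: u :: x₂ :: c :: B).Pairwise (· < ·) := by
    have : A ++ p :: x₁ :: u :: x₂ :: c :: B = (A ++ [p]) ++ x₁ :: u :: x₂ :: c :: B := by simp
    have hb : ∀ z ∈ c :: B, x₂ < z := fun z hz => ((hB z).1 hz).2
    have hright : (x₁ :: u :: x₂ :: c :: B).Pairwise (· < ·) := by
      refine List.pairwise_cons.2 ⟨?_, List.pairwise_cons.2 ⟨?_,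
        List.pairwise_cons.2 ⟨hb, hBs⟩⟩⟩
      · intro z hz
        rcases List.mem_cons.1 hz with rfl | hz
        · exact hu₁
        · rcases List.mem_cons.1 hz with rfl | hz
          · linarith
          · linarith [hb z hz]
      · intro z hz
        rcases List.mem_cons.1 hz with rfl | hz
        · exact hu₂
        · linarith [hb z hz]
    rw [this, List.pairwise_append]
    refine ⟨hAs, hright, fun a ha z hz => ?_⟩
    have ha' := ((hA a).1 ha).2
    rcases List.mem_cons.1 hz with rfl | hz
    · exact ha'
    · exact ha'.trans ((List.pairwise_cons.1 hright).1 z hz)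
  obtain ⟨a, b, l, hl, hau, hbu⟩ : ∃ a b l,
      A ++ p :: x₁ :: u :: x₂ :: c :: B = a :: b :: l ∧ a ∈ S ∧ b ∈ S := by
    rcases A with _ | ⟨a, _ | ⟨b, A⟩⟩
    · exact ⟨p, x₁, _, rfl, hp.1, hx₁S⟩
    · exact ⟨a, p, _, rfl, ((hA a).1 (by simp)).1, hp.1⟩
    · exact ⟨a, b, _, rfl, ((hA a).1 (by simp)).1, ((hA b).1 (by simp)).1⟩
  have hab : g a = g b := by
    obtain ⟨r, hr, s, hs, hrs, hmin, heq⟩ := hsmall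
    have hin : ∀ t ∈ L, t.1 ∈ a :: b :: l := fun t ht => by
      rw [← hl, hmemS]
      exact .inr ((hSmem _).2 ⟨t, ht, rfl⟩)
    have hout : ∀ x ∈ S, x = r.1 ∨ x = s.1 ∨ s.1 < x := by
      intro x hx
      obtain ⟨t, ht, rfl⟩ := (hSmem x).1 hx
      by_cases h : t = r
      · exact .inl (by rw [h])
      · by_cases h' : t = s
        · exact .inr (.inl (by rw [h']))
        · exact .inr (.inr (hmin t ht h h'))
    obtain ⟨rfl, rfl⟩ := eq_head_of_pairwise_lt (hl ▸ hsorted) (hin r hr) (hin s hs) hrs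
      (hout a hau) (hout b hbu)
    rw [hg r hr, hg s hs, heq]
  have hupd : ∀ z, ∀ x ∈ S, Function.update g u z x = g x := fun z x hx =>
    Function.update_of_ne (fun h : x = u => huS (h ▸ hx)) _ _
  have hnorm : ∀ z, interpNorm (insert (u, z) L) =
      √(2 * slopeVariation (Function.update g u z) (A ++ p :: x₁ :: u :: x₂ :: c :: B)) := by
    intro z
    rw [hl]
    refine interpNorm_eq_sqrt_slopeVariation _ _ _ _ _ (hl ▸ hsorted) ?_ ?_ ?_
    · rw [hupd z a hau, hupd z b hbu, hab]
    · intro x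
      rw [← hl, hmemS, hSmem]
      simp [eq_comm]
    · intro r hr
      rcases Finset.mem_insert.1 hr with rfl | hr
      · simp
      · rw [hupd z _ ((hSmem _).2 ⟨r, hr, rfl⟩), hg r hr]
  have hleft : ∀ z, slopeVariation (Function.update g u z) (A ++ [p, x₁]) =
      slopeVariation g (A ++ [p, x₁]) := fun z => slopeVariation_congr _ fun x hx => by
    refine hupd z x ?_
    have : x ∈ A ++ [p] ∨ x = x₁ := by simpa [or_assoc] using hx
    rcases this with h | rfl
    exacts [((hA x).1 h).1, hx₁S]
  have hright : ∀ z, slopeVariation (Function.update g u z) (x₂ :: c :: B) =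
      slopeVariation g (x₂ :: c :: B) := fun z => slopeVariation_congr _ fun x hx => by
    refine hupd z x ?_
    rcases List.mem_cons.1 hx with rfl | h
    exacts [hx₂S, ((hB x).1 h).1]
  have hins := fun z => slopeVariation_insert (Function.update g u z) hp.2 hu₁ hu₂ hc.2
    (by rw [hupd z p hp.1]; exact hSlab p hp.1) (by rw [hupd z c hc.1]; exact hSlab c hc.1)
    (by rw [hupd z _ hx₁S]; exact hSlab _ hx₁S)
    (by rw [hupd z _ hx₁S, hupd z _ hx₂S, hgx₁, hgx₂]) A B
  simp only [hleft, hright, chordSlope, hupd _ _ hp.1, hupd _ _ hx₁S, hupd _ _ hx₂S,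
    hupd _ _ hc.1, Function.update_self, hgx₁] at hins
  constructor
  · rw [hnorm, (hins y).1 rfl]
    simp only [chordSlope, hgx₁]
  · rw [hnorm, (hins (-y)).2 rfl]
    simp only [chordSlope, hgx₁]

/-- For a pair of consecutive, oppositely labeled points `x₁ < x₂` of `ℒ`, both strictly
between the outermost labeled points, the function-norm score on `(x₁, x₂)` is maximized at
the midpoint `(x₁ + x₂)/2`. -/
theorem maximin_reluNet_midpoint_max (L : Finset (ℝ × ℝ))
    (hdx : distinctX L) (hlab : labelsPM L)
    (hsmall : twoSmallestEqual L) (hlarge : twoLargestEqual L)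
    (x₁ x₂ y₁ y₂ : ℝ)
    (h₁ : (x₁, y₁) ∈ L) (h₂ : (x₂, y₂) ∈ L) (hlt : x₁ < x₂)
    (hcons : ∀ r ∈ L, ¬(x₁ < r.1 ∧ r.1 < x₂))
    (hint₁ : strictlyInterior L x₁) (hint₂ : strictlyInterior L x₂)
    (hy : y₁ ≠ y₂) :
    ∀ u : ℝ, x₁ < u → u < x₂ → scoreF L u ≤ scoreF L ((x₁ + x₂) / 2) := by
  intro u hu₁ hu₂
  have hy₁ := hlab _ h₁
  have hy₂ : y₂ = -y₁ := by
    have := hlab _ h₂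
    grind
  subst hy₂
  have hscore : ∀ x, scoreF L x =
      min (interpNorm (insert (x, y₁) L)) (interpNorm (insert (x, -y₁) L)) := by
    intro x
    rcases hy₁ with h | h <;> simp only at h <;> subst h
    · rfl
    · rw [neg_neg, min_comm]
      rfl
  obtain ⟨C, hC⟩ := exists_interpNorm_insert_eq L hdx hlab hsmall x₁ x₂ y₁ h₁ h₂ hcons hint₁ hint₂
  obtain ⟨hm₁, hm₂⟩ := hC ((x₁ + x₂) / 2) (by linarith) (by linarith)
  rw [hscore, hscore, hm₁, hm₂, (hC u hu₁ hu₂).1, (hC u hu₁ hu₂).2,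
    show (x₁ + x₂) / 2 - x₁ = (x₂ - x₁) / 2 by ring,
    show x₂ - (x₁ + x₂) / 2 = (x₂ - x₁) / 2 by ring, min_self]
  have hd : 0 < (x₂ - x₁) / 2 := by linarith
  rcases le_total u ((x₁ + x₂) / 2) with h | h
  · refine (min_le_left _ _).trans (Real.sqrt_le_sqrt ?_)
    have := div_le_div_of_nonneg_left zero_le_four hd (by linarith : (x₂ - x₁) / 2 ≤ x₂ - u)
    linarith
  · refine (min_le_right _ _).trans (Real.sqrt_le_sqrt ?_)
    have := div_le_div_of_nonneg_left zero_le_four hd (by linarith : (x₂ - x₁) / 2 ≤ u - x₁)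
    linarith
end

section
/- Let ℒ be a finite labeled set in ℝ×{−1,+1} with distinct first coordinates whose two smallest labeled points carry equal labels and whose two largest labeled points carry equal labels. Let x₁ < x₂ and x₃ < x₄ be two pairs of consecutive labeled points of ℒ, each pair lying strictly between the outermost labeled points, with y₁ ≠ y₂ and y₃ ≠ y₄. If x₂ − x₁ ≥ x₄ − x₃, then score_F((x₁+x₂)/2) ≤ score_F((x₃+x₄)/2). -/
open Matrix MeasureTheory

/-- The secant slope between two points of the list, for values read off by `f`. -/
noncomputable def secant (f : ℝ × ℝ → ℝ) (p q : ℝ × ℝ) : ℝ := (f q - f p) / (q.1 - p.1)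

/-- The total variation of the sequence of secant slopes along a list of points. -/
noncomputable def secantVar (f : ℝ × ℝ → ℝ) : List (ℝ × ℝ) → ℝ
  | p :: q :: r :: l => |secant f q r - secant f p q| + secantVar f (q :: r :: l)
  | _ => 0

/-- The kinks of the linear spline through a list of points. -/
noncomputable def splineKinks : List (ℝ × ℝ) → ℝ → ℝ
  | p :: q :: r :: l => fun x =>
      (secant Prod.snd q r - secant Prod.snd p q) * max 0 (x - q.1) + splineKinks (q :: r :: l) x
  | _ => fun _ => 0

/-- The list is strictly increasing in the first coordinate. -/
def IncreasingFst (l : List (ℝ × ℝ)) : Prop := l.Pairwise fun p q => p.1 < q.1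

theorem secantVar_congr {f g : ℝ × ℝ → ℝ} :
    ∀ {l : List (ℝ × ℝ)}, (∀ p ∈ l, f p = g p) → secantVar f l = secantVar g l
  | [], _ => rfl
  | [_], _ => rfl
  | [_, _], _ => rfl
  | p :: q :: r :: l, h => by
      have ih := secantVar_congr (l := q :: r :: l) fun z hz => h z (List.mem_cons_of_mem _ hz)
      simp only [secantVar, secant, ih, h p (by simp), h q (by simp), h r (by simp)]

theorem secantVar_append (f : ℝ × ℝ → ℝ) (p q : ℝ × ℝ) (B : List (ℝ × ℝ)) :
    ∀ A : List (ℝ × ℝ),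
      secantVar f (A ++ p :: q :: B) = secantVar f (A ++ [p, q]) + secantVar f (p :: q :: B)
  | [] => by simp [secantVar]
  | [a] => by simp [secantVar]
  | [a, b] => by simp [secantVar, add_assoc]
  | a :: b :: c :: A => by
      have ih := secantVar_append f p q B (b :: c :: A)
      simp only [List.cons_append, secantVar] at ih ⊢
      rw [ih, add_assoc]

theorem secantVar_sum_le {N : ℕ} (v : Fin N → ℝ) (g : Fin N → ℝ × ℝ → ℝ) (c : ℝ) :
    ∀ l : List (ℝ × ℝ), secantVar (fun p => ∑ n, v n * g n p + c) l ≤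
      ∑ n, |v n| * secantVar (g n) l
  | [] => by simp [secantVar]
  | [_] => by simp [secantVar]
  | [_, _] => by simp [secantVar]
  | p :: q :: r :: l => by
      have ih := secantVar_sum_le v g c (q :: r :: l)
      have hs (x y : ℝ × ℝ) : secant (fun p => ∑ n, v n * g n p + c) x y =
          ∑ n, v n * secant (g n) x y := by
        simp only [secant, add_sub_add_right_eq_sub, ← Finset.sum_sub_distrib, Finset.sum_div]
        exact Finset.sum_congr rfl fun n _ => by ring
      simp only [secantVar, hs, mul_add, Finset.sum_add_distrib, ← Finset.sum_sub_distrib,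
        ← mul_sub]
      refine add_le_add ((Finset.abs_sum_le_sum_abs _ _).trans_eq ?_) ih
      exact Finset.sum_congr rfl fun n _ => abs_mul _ _

/-- Along a convex function, the secant slopes increase, so their variation telescopes. -/
theorem secantVar_le_of_convexOn {g : ℝ → ℝ} (hg : ConvexOn ℝ Set.univ g) {U : ℝ}
    (hU : ∀ x y, x < y → (g y - g x) / (y - x) ≤ U) :
    ∀ {p q : ℝ × ℝ} {l : List (ℝ × ℝ)}, IncreasingFst (p :: q :: l) →
      secantVar (fun z => g z.1) (p :: q :: l) ≤ U - secant (fun z => g z.1) p q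
  | p, q, [], h => by
      have hpq : p.1 < q.1 := List.rel_of_pairwise_cons h (by simp)
      simpa [secantVar, secant] using hU _ _ hpq
  | p, q, r :: l, h => by
      have hpq : p.1 < q.1 := List.rel_of_pairwise_cons h (by simp)
      have hqr : q.1 < r.1 := List.rel_of_pairwise_cons h.of_cons (by simp)
      have ih := secantVar_le_of_convexOn hg hU (p := q) (q := r) (l := l) h.of_cons
      have hmono : secant (fun z => g z.1) p q ≤ secant (fun z => g z.1) q r :=
        hg.slope_mono_adjacent (Set.mem_univ _) (Set.mem_univ _) hpq hqr
      rw [secantVar, abs_of_nonneg (sub_nonneg.2 hmono)]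
      linarith

theorem secantVar_relu_le (u b : ℝ) {l : List (ℝ × ℝ)} (hl : IncreasingFst l) :
    secantVar (fun z => max 0 (u * z.1 + b)) l ≤ |u| := by
  match l, hl with
  | [], _ => exact abs_nonneg u
  | [_], _ => exact abs_nonneg u
  | p :: q :: l, hl =>
    have hg : ConvexOn ℝ Set.univ fun x : ℝ => max 0 (u * x + b) := by
      refine ⟨convex_univ, fun x _ y _ s t hs ht hst => ?_⟩
      simp only [smul_eq_mul]
      refine max_le (by positivity) ?_
      have hx := mul_le_mul_of_nonneg_left (le_max_right 0 (u * x + b)) hs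
      have hy := mul_le_mul_of_nonneg_left (le_max_right 0 (u * y + b)) ht
      have hb : b = s * b + t * b := by rw [← add_mul, hst, one_mul]
      linarith
    have hpq : p.1 < q.1 := List.rel_of_pairwise_cons hl (by simp)
    rcases le_total 0 u with hu | hu
    · have hU (x y : ℝ) (h : x < y) :
          (max 0 (u * y + b) - max 0 (u * x + b)) / (y - x) ≤ u := by
        rw [div_le_iff₀ (sub_pos.2 h), sub_le_iff_le_add]
        have := mul_nonneg hu (sub_pos.2 h).le
        have h0 := le_max_left 0 (u * x + b)
        have h1 := le_max_right 0 (u * x + b)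
        exact max_le (by linarith) (by linarith)
      have h := secantVar_le_of_convexOn hg hU hl
      have h0 : 0 ≤ secant (fun z => max 0 (u * z.1 + b)) p q :=
        div_nonneg (sub_nonneg.2 (max_le_max le_rfl (by
          have := mul_le_mul_of_nonneg_left hpq.le hu
          linarith))) (sub_pos.2 hpq).le
      rw [abs_of_nonneg hu]
      linarith
    · have hU (x y : ℝ) (h : x < y) :
          (max 0 (u * y + b) - max 0 (u * x + b)) / (y - x) ≤ 0 := by
        refine div_nonpos_of_nonpos_of_nonneg (sub_nonpos.2 (max_le_max le_rfl ?_))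
          (sub_pos.2 h).le
        have := mul_le_mul_of_nonpos_left h.le hu
        linarith
      have h := secantVar_le_of_convexOn hg hU hl
      have h0 : u ≤ secant (fun z => max 0 (u * z.1 + b)) p q := by
        rw [secant, le_div_iff₀ (sub_pos.2 hpq), le_sub_iff_add_le]
        have := mul_nonpos_of_nonpos_of_nonneg hu (sub_pos.2 hpq).le
        have h0 := le_max_left 0 (u * q.1 + b)
        have h1 := le_max_right 0 (u * q.1 + b)
        rw [← le_sub_iff_add_le']
        exact max_le (by linarith) (by linarith)
      rw [abs_of_nonpos hu]
      linarith

theorem secantVar_le_of_interpolates {N : ℕ} {v u b : Fin N → ℝ} {c : ℝ} {l : List (ℝ × ℝ)}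
    (hl : IncreasingFst l) (h : ∀ q ∈ l, reluNet N v u b c q.1 = q.2) :
    2 * secantVar Prod.snd l ≤ (∑ n, v n ^ 2) + ∑ n, u n ^ 2 := by
  rw [secantVar_congr fun q hq => (h q hq).symm]
  have h1 := secantVar_sum_le v (fun n z => max 0 (u n * z.1 + b n)) c l
  rw [← Finset.sum_add_distrib]
  calc _ ≤ 2 * ∑ n, |v n| * secantVar (fun z => max 0 (u n * z.1 + b n)) l :=
        mul_le_mul_of_nonneg_left h1 zero_le_two
    _ ≤ _ := by
      rw [Finset.mul_sum]
      refine Finset.sum_le_sum fun n _ => ?_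
      have h2 := mul_le_mul_of_nonneg_left (secantVar_relu_le (u n) (b n) hl) (abs_nonneg (v n))
      have h3 := two_mul_le_add_sq |v n| |u n|
      rw [sq_abs, sq_abs] at h3
      linarith

theorem splineKinks_eq_zero {x : ℝ} :
    ∀ {l : List (ℝ × ℝ)}, (∀ q ∈ l, x ≤ q.1) → splineKinks l x = 0
  | [], _ => rfl
  | [_], _ => rfl
  | [_, _], _ => rfl
  | p :: q :: r :: l, h => by
      have hq := h q (by simp)
      simp only [splineKinks]
      rw [splineKinks_eq_zero fun z hz => h z (List.mem_cons_of_mem _ hz), max_eq_left (by linarith), mul_zero, add_zero]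

theorem snd_eq_add_splineKinks :
    ∀ {p q : ℝ × ℝ} {l : List (ℝ × ℝ)}, IncreasingFst (p :: q :: l) → ∀ z ∈ p :: q :: l,
      z.2 = p.2 + secant Prod.snd p q * (z.1 - p.1) + splineKinks (p :: q :: l) z.1
  | p, q, [], h, z, hz => by
      have hpq : p.1 < q.1 := List.rel_of_pairwise_cons h (by simp)
      have := (sub_pos.2 hpq).ne'
      rcases List.mem_pair.1 hz with rfl | rfl
      · simp [splineKinks]
      · simp only [splineKinks, secant]
        field_simp
        ring
  | p, q, r :: l, h, z, hz => by
      have hpq : p.1 < q.1 := List.rel_of_pairwise_cons h (by simp)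
      rcases List.mem_cons.1 hz with rfl | hz
      · rw [splineKinks_eq_zero]
        · simp
        · intro w hw
          rcases List.mem_cons.1 hw with rfl | hw
          · exact le_rfl
          · exact (List.rel_of_pairwise_cons h hw).le
      · have hqz : q.1 ≤ z.1 := by
          rcases List.mem_cons.1 hz with rfl | hz
          · exact le_rfl
          · exact (List.rel_of_pairwise_cons h.of_cons hz).le
        have ih := snd_eq_add_splineKinks (p := q) (q := r) (l := l) h.of_cons z hz
        have hq : q.2 = p.2 + secant Prod.snd p q * (q.1 - p.1) := by
          have := (sub_pos.2 hpq).ne'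
          rw [secant]
          field_simp
          ring
        simp only [splineKinks]
        rw [max_eq_right (sub_nonneg.2 hqz)]
        rw [hq] at ih
        linarith

theorem exists_weights_splineKinks :
    ∀ l : List (ℝ × ℝ), ∃ (N : ℕ) (v u b : Fin N → ℝ),
      (∀ x, ∑ n, v n * max 0 (u n * x + b n) = splineKinks l x) ∧
        (∑ n, v n ^ 2) + ∑ n, u n ^ 2 = 2 * secantVar Prod.snd l
  | [] => ⟨0, 0, 0, 0, by simp [splineKinks, secantVar]⟩
  | [_] => ⟨0, 0, 0, 0, by simp [splineKinks, secantVar]⟩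
  | [_, _] => ⟨0, 0, 0, 0, by simp [splineKinks, secantVar]⟩
  | p :: q :: r :: l => by
      obtain ⟨N, v, u, b, hf, hw⟩ := exists_weights_splineKinks (q :: r :: l)
      set d := secant Prod.snd q r - secant Prod.snd p q with hd
      have hs : √|d| * √|d| = |d| := Real.mul_self_sqrt (abs_nonneg d)
      obtain ⟨e, he, hed⟩ : ∃ e : ℝ, e * e = 1 ∧ e * |d| = d := by
        rcases abs_cases d with ⟨h, _⟩ | ⟨h, _⟩
        · exact ⟨1, by norm_num, by rw [h, one_mul]⟩
        · exact ⟨-1, by norm_num, by rw [h]; ring⟩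
      refine ⟨N + 1, Fin.cons (e * √|d|) v, Fin.cons √|d| u, Fin.cons (-(√|d| * q.1)) b, ?_, ?_⟩
      · intro x
        simp only [Fin.sum_univ_succ, Fin.cons_zero, Fin.cons_succ, hf, splineKinks, ← hd]
        have hmax := mul_max_of_nonneg 0 (x - q.1) (Real.sqrt_nonneg |d|)
        rw [mul_zero] at hmax
        rw [← sub_eq_add_neg, ← mul_sub, ← hmax]
        linear_combination (e * max 0 (x - q.1)) * hs + max 0 (x - q.1) * hed
      · simp only [Fin.sum_univ_succ, Fin.cons_zero, Fin.cons_succ, secantVar, ← hd]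
        linear_combination hw + (√|d| * √|d|) * he + 2 * hs

theorem interpNorm_eq {S : Finset (ℝ × ℝ)} {p q : ℝ × ℝ} {l : List (ℝ × ℝ)}
    (hS : ∀ z, z ∈ S ↔ z ∈ p :: q :: l) (hl : IncreasingFst (p :: q :: l)) (hpq : p.2 = q.2) :
    interpNorm S = √(2 * secantVar Prod.snd (p :: q :: l)) := by
  refine IsLeast.csInf_eq ⟨?_, ?_⟩
  · obtain ⟨N, v, u, b, hf, hw⟩ := exists_weights_splineKinks (p :: q :: l)
    refine ⟨N, v, u, b, p.2, fun z hz => ?_, by rw [weightNorm, hw]⟩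
    have h := snd_eq_add_splineKinks hl z ((hS z).1 hz)
    rw [secant, hpq, sub_self, zero_div, zero_mul, add_zero] at h
    rw [reluNet, hf, hpq, h, add_comm]
  · rintro _ ⟨N, v, u, b, c, h, rfl⟩
    exact Real.sqrt_le_sqrt (secantVar_le_of_interpolates hl fun z hz => h z ((hS z).2 hz))

theorem exists_increasingFst (L : Finset (ℝ × ℝ)) (hdx : distinctX L) :
    ∃ l : List (ℝ × ℝ), IncreasingFst l ∧ ∀ z, z ∈ L ↔ z ∈ l := by
  induction L using Finset.induction_on_max_value (fun z : ℝ × ℝ => z.1) with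
  | empty => exact ⟨[], List.Pairwise.nil, by simp⟩
  | insert a s ha hmax ih =>
    obtain ⟨l, hl, hm⟩ := ih fun p hp q hq => hdx p (Finset.mem_insert_of_mem hp) q
      (Finset.mem_insert_of_mem hq)
    refine ⟨l ++ [a], ?_, fun z => ?_⟩
    · refine List.pairwise_append.2 ⟨hl, List.pairwise_singleton _ _, fun z hz w hw => ?_⟩
      rw [List.mem_singleton.1 hw]
      have hzs := (hm z).2 hz
      refine lt_of_le_of_ne (hmax z hzs) fun h => ha ?_
      rwa [← hdx z (Finset.mem_insert_of_mem hzs) a (Finset.mem_insert_self _ _) h]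
    · simp [hm, or_comm]

theorem exists_eq_append_of_consecutive {l : List (ℝ × ℝ)} (hl : IncreasingFst l) {p q : ℝ × ℝ}
    (hp : p ∈ l) (hq : q ∈ l) (hpq : p.1 < q.1) (hcons : ∀ r ∈ l, ¬(p.1 < r.1 ∧ r.1 < q.1)) :
    ∃ A B, l = A ++ p :: q :: B := by
  obtain ⟨A, C, rfl⟩ := List.append_of_mem hp
  obtain ⟨-, hC, hAC⟩ := List.pairwise_append.1 hl
  have hqC : q ∈ C := by
    rcases List.mem_append.1 hq with h | h
    · exact absurd (hAC q h p (by simp)) hpq.not_gt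
    · rcases List.mem_cons.1 h with rfl | h
      · exact absurd hpq (lt_irrefl _)
      · exact h
  obtain ⟨D, B, rfl⟩ := List.append_of_mem hqC
  match D with
  | [] => exact ⟨A, B, rfl⟩
  | d :: D =>
    refine absurd ⟨List.rel_of_pairwise_cons hC (by simp), ?_⟩ (hcons d (by simp))
    exact (List.pairwise_append.1 hC.of_cons).2.2 d (by simp) q (by simp)

theorem snd_eq_of_twoSmallestEqual {L : Finset (ℝ × ℝ)} (h : twoSmallestEqual L) {a b : ℝ × ℝ}
    {l : List (ℝ × ℝ)} (hm : ∀ z, z ∈ L ↔ z ∈ a :: b :: l) (hl : IncreasingFst (a :: b :: l)) :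
    a.2 = b.2 := by
  obtain ⟨p, hp, q, hq, hpq, hmin, hy⟩ := h
  have ha (z : ℝ × ℝ) (hz : z ∈ L) : z = a ∨ a.1 < z.1 :=
    (List.mem_cons.1 ((hm z).1 hz)).imp_right (List.rel_of_pairwise_cons hl)
  have hb (z : ℝ × ℝ) (hz : z ∈ L) : z = a ∨ z = b ∨ b.1 < z.1 :=
    (List.mem_cons.1 ((hm z).1 hz)).imp_right fun h =>
      (List.mem_cons.1 h).imp_right (List.rel_of_pairwise_cons hl.of_cons)
  have hab : a.1 < b.1 := List.rel_of_pairwise_cons hl (by simp)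
  have haL := (hm a).2 (by simp)
  have hbL := (hm b).2 (by simp)
  have hap : a = p := by
    by_contra hne
    rcases ha p hp with rfl | hlt
    · exact hne rfl
    · by_cases haq : a = q
      · rw [haq] at hlt
        exact lt_asymm hlt hpq
      · exact lt_asymm (hlt.trans hpq) (hmin a haL hne haq)
  have hbq : b = q := by
    by_contra hne
    have hbp : b ≠ p := by
      rintro rfl
      rw [hap] at hab
      exact lt_irrefl _ hab
    have hlt := hmin b hbL hbp hne
    rcases hb q hq with rfl | rfl | h
    · rw [hap] at hpq
      exact lt_irrefl _ hpq
    · exact hne rfl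
    · exact lt_asymm h hlt
  rw [hap, hbq, hy]

/-- Inserting a point labeled `±1` halfway between two oppositely labeled points of a `±1`-labeled
list raises the variation of the secant slopes by four over the length of the gap. -/
theorem secantVar_insert_midpoint {a p q b : ℝ × ℝ} (ha : a.2 = 1 ∨ a.2 = -1)
    (hp : p.2 = 1 ∨ p.2 = -1) (hq : q.2 = 1 ∨ q.2 = -1) (hb : b.2 = 1 ∨ b.2 = -1)
    (hap : a.1 < p.1) (hpq : p.1 < q.1) (hqb : q.1 < b.1) (hne : p.2 ≠ q.2) {y : ℝ}
    (hy : y = 1 ∨ y = -1) (A B : List (ℝ × ℝ)) :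
    secantVar Prod.snd (A ++ a :: p :: ((p.1 + q.1) / 2, y) :: q :: b :: B) =
      secantVar Prod.snd (A ++ a :: p :: q :: b :: B) + 4 / (q.1 - p.1) := by
  rw [secantVar_append _ a p, secantVar_append _ a p (q :: b :: B)]
  simp only [secantVar]
  have hg : 0 < (q.1 - p.1)⁻¹ := inv_pos.2 (sub_pos.2 hpq)
  have h1 : (p.1 + q.1) / 2 - p.1 = (q.1 - p.1) / 2 := by ring
  have h2 : q.1 - (p.1 + q.1) / 2 = (q.1 - p.1) / 2 := by ring
  have hα : 0 ≤ p.2 * secant Prod.snd a p := by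
    rw [secant, ← mul_div_assoc]
    refine div_nonneg ?_ (sub_pos.2 hap).le
    rcases hp with hp | hp <;> rcases ha with ha | ha <;> norm_num [hp, ha]
  have hβ : q.2 * secant Prod.snd q b ≤ 0 := by
    rw [secant, ← mul_div_assoc]
    refine div_nonpos_of_nonpos_of_nonneg ?_ (sub_pos.2 hqb).le
    rcases hq with hq | hq <;> rcases hb with hb | hb <;> norm_num [hq, hb]
  generalize secant Prod.snd a p = α at *
  generalize secant Prod.snd q b = β at *
  simp only [secant, h1, h2]
  simp only [div_eq_mul_inv, mul_inv, inv_inv]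
  generalize (q.1 - p.1)⁻¹ = s at *
  rcases hp with hp | hp <;> rcases hq with hq | hq <;>
    try exact absurd (hp.trans hq.symm) hne
  all_goals
    rw [hp] at hα
    rw [hq] at hβ
    rcases hy with rfl | rfl <;> rw [hp, hq] <;> norm_num only <;>
      repeat first | rw [abs_of_nonneg (by linarith)] | rw [abs_of_nonpos (by linarith)]
  all_goals ring

theorem scoreF_midpoint {L : Finset (ℝ × ℝ)} {l : List (ℝ × ℝ)} (hl : IncreasingFst l)
    (hm : ∀ z, z ∈ L ↔ z ∈ l) (hlab : labelsPM L) (hsmall : twoSmallestEqual L) {p q : ℝ × ℝ}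
    (hp : p ∈ L) (hq : q ∈ L) (hpq : p.1 < q.1) (hcons : ∀ r ∈ L, ¬(p.1 < r.1 ∧ r.1 < q.1))
    (hintp : strictlyInterior L p.1) (hintq : strictlyInterior L q.1) (hne : p.2 ≠ q.2) :
    scoreF L ((p.1 + q.1) / 2) = √(2 * (secantVar Prod.snd l + 4 / (q.1 - p.1))) := by
  obtain ⟨A, B, rfl⟩ := exists_eq_append_of_consecutive hl ((hm p).1 hp) ((hm q).1 hq) hpq
    fun r hr => hcons r ((hm r).2 hr)
  obtain ⟨hA, hpB, hAB⟩ := List.pairwise_append.1 hl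
  obtain ⟨A, a, rfl⟩ : ∃ A' a, A = A' ++ [a] := by
    rcases List.eq_nil_or_concat A with rfl | h
    · obtain ⟨a, ha, hap⟩ := hintp.1
      rcases List.mem_cons.1 ((hm a).1 ha) with rfl | h
      · exact absurd hap (lt_irrefl _)
      · exact absurd hap (List.rel_of_pairwise_cons hpB h).not_gt
    · simpa using h
  obtain ⟨b, B, rfl⟩ : ∃ b B', B = b :: B' := by
    rcases B with _ | ⟨b, B⟩
    · obtain ⟨b, hb, hqb⟩ := hintq.2
      rcases List.mem_append.1 ((hm b).1 hb) with h | h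
      · exact absurd hqb (hAB b h q (by simp)).not_gt
      · rcases List.mem_pair.1 h with rfl | rfl
        · exact absurd hqb hpq.not_gt
        · exact absurd hqb (lt_irrefl _)
    · exact ⟨b, B, rfl⟩
  have hap : a.1 < p.1 := hAB a (by simp) p (by simp)
  have hqb : q.1 < b.1 := List.rel_of_pairwise_cons hpB.of_cons (by simp)
  have key (y : ℝ) (hy : y = 1 ∨ y = -1) : interpNorm (insert ((p.1 + q.1) / 2, y) L) =
      √(2 * (secantVar Prod.snd ((A ++ [a]) ++ p :: q :: b :: B) + 4 / (q.1 - p.1))) := by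
    have hlab' (z : ℝ × ℝ) (hz : z ∈ (A ++ [a]) ++ p :: q :: b :: B) : z.2 = 1 ∨ z.2 = -1 :=
      hlab z ((hm z).2 hz)
    have hvar := secantVar_insert_midpoint (hlab' a (by simp)) (hlab' p (by simp))
      (hlab' q (by simp)) (hlab' b (by simp)) hap hpq hqb hne hy A B
    have hmem (z : ℝ × ℝ) : z ∈ insert ((p.1 + q.1) / 2, y) L ↔
        z ∈ A ++ a :: p :: ((p.1 + q.1) / 2, y) :: q :: b :: B := by
      rw [Finset.mem_insert, hm]
      simp only [List.mem_append, List.mem_cons, List.not_mem_nil, or_false]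
      tauto
    have hinc : IncreasingFst (A ++ a :: p :: ((p.1 + q.1) / 2, y) :: q :: b :: B) := by
      have hpm : p.1 < (p.1 + q.1) / 2 := by linarith
      have hmq : (p.1 + q.1) / 2 < q.1 := by linarith
      have hqB := hpB.of_cons
      suffices h : IncreasingFst ((A ++ [a]) ++ p :: ((p.1 + q.1) / 2, y) :: q :: b :: B) by
        simpa using h
      refine List.pairwise_append.2 ⟨hA, List.pairwise_cons.2 ⟨fun z hz => ?_,
        List.pairwise_cons.2 ⟨fun z hz => ?_, hqB⟩⟩, fun z hz w hw => ?_⟩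
      · rcases List.mem_cons.1 hz with rfl | hz
        · exact hpm
        · exact List.rel_of_pairwise_cons hpB hz
      · rcases List.mem_cons.1 hz with rfl | hz
        · exact hmq
        · exact hmq.trans (List.rel_of_pairwise_cons hqB hz)
      · rcases List.mem_cons.1 hw with rfl | hw
        · exact hAB z hz _ (by simp)
        · rcases List.mem_cons.1 hw with rfl | hw
          · exact (hAB z hz p (by simp)).trans hpm
          · exact hAB z hz w (List.mem_cons_of_mem _ hw)
    rw [List.append_assoc, List.singleton_append, ← hvar]
    rw [List.append_assoc, List.singleton_append] at hm hl
    match A with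
    | [] => exact interpNorm_eq hmem hinc (snd_eq_of_twoSmallestEqual hsmall hm hl)
    | [c] => exact interpNorm_eq hmem hinc (snd_eq_of_twoSmallestEqual hsmall hm hl)
    | c :: d :: A => exact interpNorm_eq hmem hinc (snd_eq_of_twoSmallestEqual hsmall hm hl)
  rw [scoreF, key 1 (Or.inl rfl), key (-1) (Or.inr rfl), min_self]

/-- For two pairs of consecutive, oppositely labeled points of `ℒ`, each lying strictly between
the outermost labeled points, the function-norm score at the midpoint of the wider gap is at
most the score at the midpoint of the narrower gap. -/
theorem maximin_reluNet_shorter_gap_higher_score (L : Finset (ℝ × ℝ))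
    (hdx : distinctX L) (hlab : labelsPM L)
    (hsmall : twoSmallestEqual L) (hlarge : twoLargestEqual L)
    (x₁ x₂ x₃ x₄ y₁ y₂ y₃ y₄ : ℝ)
    (h₁ : (x₁, y₁) ∈ L) (h₂ : (x₂, y₂) ∈ L) (h₃ : (x₃, y₃) ∈ L) (h₄ : (x₄, y₄) ∈ L)
    (h12 : x₁ < x₂) (h34 : x₃ < x₄)
    (hcons12 : ∀ r ∈ L, ¬(x₁ < r.1 ∧ r.1 < x₂))
    (hcons34 : ∀ r ∈ L, ¬(x₃ < r.1 ∧ r.1 < x₄))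
    (hint₁ : strictlyInterior L x₁) (hint₂ : strictlyInterior L x₂)
    (hint₃ : strictlyInterior L x₃) (hint₄ : strictlyInterior L x₄)
    (hy12 : y₁ ≠ y₂) (hy34 : y₃ ≠ y₄)
    (hlen : x₄ - x₃ ≤ x₂ - x₁) :
    scoreF L ((x₁ + x₂) / 2) ≤ scoreF L ((x₃ + x₄) / 2) := by
  obtain ⟨l, hl, hm⟩ := exists_increasingFst L hdx
  have h12' := scoreF_midpoint hl hm hlab hsmall h₁ h₂ h12 hcons12 hint₁ hint₂ hy12
  have h34' := scoreF_midpoint hl hm hlab hsmall h₃ h₄ h34 hcons34 hint₃ hint₄ hy34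
  rw [h12', h34']
  have := sub_pos.2 h34
  gcongr
end

section
/- Let ℒ be a finite labeled set in ℝ×{−1,+1} with distinct first coordinates whose two smallest labeled points carry equal labels and whose two largest labeled points carry equal labels. Let x₅ < x₆ be two consecutive labeled points of ℒ, lying strictly between the outermost labeled points, with equal labels y₅ = y₆. Then for every v with x₅ < v < x₆, score_F(v) = m(ℒ); in particular the score is constant on (x₅, x₆). -/
open Matrix MeasureTheory

/-- A ReLU unit splits into two units with the same slope and convex weights so that the result
agrees with the unit outside `(p, q)` and with its chord on `[p, q]`. -/
lemma exists_split_relu {p q : ℝ} (hpq : p < q) (u b : ℝ) :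
    ∃ θ b₁ b₂ : ℝ, 0 ≤ θ ∧ θ ≤ 1 ∧
      (∀ x, x ≤ p ∨ q ≤ x →
        θ * max 0 (u * x + b₁) + (1 - θ) * max 0 (u * x + b₂) = max 0 (u * x + b)) ∧
      (∀ x, p ≤ x → x ≤ q →
        (q - p) * (θ * max 0 (u * x + b₁) + (1 - θ) * max 0 (u * x + b₂)) =
          (q - x) * max 0 (u * p + b) + (x - p) * max 0 (u * q + b)) := by
  have hd : 0 < q - p := sub_pos.2 hpq
  rcases le_or_gt 0 ((u * p + b) * (u * q + b)) with h | h
  · refine ⟨1, b, b, zero_le_one, le_rfl, fun x _ => by ring, fun x hx₁ hx₂ => ?_⟩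
    have key : (q - p) * (u * x + b) = (q - x) * (u * p + b) + (x - p) * (u * q + b) := by ring
    have h₁ : 0 ≤ q - x := by linarith
    have h₂ : 0 ≤ x - p := by linarith
    rcases mul_nonneg_iff.1 h with ⟨hp, hq⟩ | ⟨hp, hq⟩
    · have hx : 0 ≤ u * x + b := by
        have := add_nonneg (mul_nonneg h₁ hp) (mul_nonneg h₂ hq)
        exact nonneg_of_mul_nonneg_right (key ▸ this) hd
      rw [max_eq_right hp, max_eq_right hq, max_eq_right hx]
      linarith
    · have hx : u * x + b ≤ 0 := by
        have h₃ := mul_nonneg h₁ (neg_nonneg.2 hp)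
        have h₄ := mul_nonneg h₂ (neg_nonneg.2 hq)
        by_contra! hx
        have := mul_pos hd hx
        linarith
      rw [max_eq_left hp, max_eq_left hq, max_eq_left hx]
      ring
  · have hu : u ≠ 0 := by
      rintro rfl
      nlinarith [mul_self_nonneg b]
    have hθ : (u * q + b) / (u * (q - p)) * (u * (q - p)) = u * q + b :=
      div_mul_cancel₀ _ (mul_ne_zero hu hd.ne')
    set θ := (u * q + b) / (u * (q - p))
    have hb : u * p + b = -((1 - θ) * (u * (q - p))) := by linarith
    have hθu : 0 < θ * (1 - θ) := by
      rw [hb, ← hθ] at h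
      have : 0 < (θ * (1 - θ)) * (u * (q - p)) ^ 2 := by linarith
      exact pos_of_mul_pos_left this (sq_nonneg _)
    have hθ₀ : 0 < θ := by nlinarith
    have hθ₁ : 0 < 1 - θ := by nlinarith
    have hbe : b = -(u * (θ * p + (1 - θ) * q)) := by linarith
    have hmax : ∀ r x : ℝ, 0 ≤ x → max 0 (r * x) = x * max 0 r := fun r x hx => by
      rw [mul_comm r, mul_max_of_nonneg _ _ hx, mul_zero]
    have hmax' : ∀ r x : ℝ, x ≤ 0 → max 0 (r * x) = -x * max 0 (-r) := fun r x hx => by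
      rw [← hmax _ _ (neg_nonneg.2 hx), neg_mul_neg]
    refine ⟨θ, -(u * p), -(u * q), hθ₀.le, by linarith, fun x hx => ?_, fun x hx₁ hx₂ => ?_⟩
    · have e₁ : u * x + -(u * p) = u * (x - p) := by ring
      have e₂ : u * x + -(u * q) = u * (x - q) := by ring
      have e₃ : u * x + b = u * (θ * (x - p) + (1 - θ) * (x - q)) := by rw [hbe]; ring
      rw [e₁, e₂, e₃]
      rcases hx with hx | hx
      · rw [hmax' u (x - p) (by linarith), hmax' u (x - q) (by linarith), hmax' u _ (by nlinarith)]
        ring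
      · rw [hmax u (x - p) (by linarith), hmax u (x - q) (by linarith), hmax u _ (by nlinarith)]
        ring
    · have e₁ : u * x + -(u * p) = u * (x - p) := by ring
      have e₂ : u * x + -(u * q) = u * (x - q) := by ring
      have e₃ : u * p + b = u * ((1 - θ) * (p - q)) := by linarith
      have e₄ : u * q + b = u * (θ * (q - p)) := by linarith
      rw [e₁, e₂, e₃, e₄, hmax u (x - p) (by linarith), hmax' u (x - q) (by linarith),
        hmax' u _ (by nlinarith), hmax u _ (by nlinarith)]
      ring

/-- The chord replacement of a network over `[p, q]` is a network of the same weight norm. -/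
lemma exists_reluNet_chord {p q : ℝ} (hpq : p < q) (N : ℕ) (v u b : Fin N → ℝ) (c : ℝ) :
    ∃ (M : ℕ) (v' u' b' : Fin M → ℝ), weightNorm M v' u' = weightNorm N v u ∧
      (∀ x, x ≤ p ∨ q ≤ x → reluNet M v' u' b' c x = reluNet N v u b c x) ∧
      (∀ x, p ≤ x → x ≤ q → (q - p) * reluNet M v' u' b' c x =
        (q - x) * reluNet N v u b c p + (x - p) * reluNet N v u b c q) := by
  choose θ b₁ b₂ hθ₀ hθ₁ hout hin using fun n => exists_split_relu hpq (u n) (b n)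
  have hθ₁' : ∀ n, 0 ≤ 1 - θ n := fun n => sub_nonneg.2 (hθ₁ n)
  have hscale : ∀ t w r s x : ℝ, 0 ≤ t →
      √t * w * max 0 (√t * r * x + √t * s) = w * (t * max 0 (r * x + s)) := by
    intro t w r s x ht
    have : √t * r * x + √t * s = √t * (r * x + s) := by ring
    have hm : max 0 (√t * (r * x + s)) = √t * max 0 (r * x + s) := by
      rw [mul_max_of_nonneg _ _ (Real.sqrt_nonneg t), mul_zero]
    rw [this, hm]
    calc _ = √t * √t * w * max 0 (r * x + s) := by ring
      _ = _ := by rw [Real.mul_self_sqrt ht]; ring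
  let v' : Fin (N + N) → ℝ :=
    Fin.append (fun n => √(θ n) * v n) (fun n => √(1 - θ n) * v n)
  let u' : Fin (N + N) → ℝ :=
    Fin.append (fun n => √(θ n) * u n) (fun n => √(1 - θ n) * u n)
  let b' : Fin (N + N) → ℝ :=
    Fin.append (fun n => √(θ n) * b₁ n) (fun n => √(1 - θ n) * b₂ n)
  have hnet : ∀ x, reluNet (N + N) v' u' b' c x =
      (∑ n, v n * (θ n * max 0 (u n * x + b₁ n) + (1 - θ n) * max 0 (u n * x + b₂ n))) + c := by
    intro x
    simp only [reluNet, v', u', b', Fin.sum_univ_add, Fin.append_left, Fin.append_right]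
    rw [← Finset.sum_add_distrib]
    congr 1
    refine Finset.sum_congr rfl fun n _ => ?_
    rw [hscale _ _ _ _ _ (hθ₀ n), hscale _ _ _ _ _ (hθ₁' n)]
    ring
  have hsq : ∀ w : Fin N → ℝ, (∑ n, (Fin.append (fun n => √(θ n) * w n)
      (fun n => √(1 - θ n) * w n) : Fin (N + N) → ℝ) n ^ 2) = ∑ n, w n ^ 2 := by
    intro w
    simp only [Fin.sum_univ_add, Fin.append_left, Fin.append_right]
    rw [← Finset.sum_add_distrib]
    refine Finset.sum_congr rfl fun n _ => ?_
    rw [mul_pow, mul_pow, Real.sq_sqrt (hθ₀ n), Real.sq_sqrt (hθ₁' n)]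
    ring
  refine ⟨N + N, v', u', b', ?_, fun x hx => ?_, fun x hx₁ hx₂ => ?_⟩
  · simp only [weightNorm, v', u', hsq]
  · rw [hnet, reluNet]
    congr 1
    exact Finset.sum_congr rfl fun n _ => by rw [hout n x hx]
  · have h : (q - p) * ∑ n, v n *
        (θ n * max 0 (u n * x + b₁ n) + (1 - θ n) * max 0 (u n * x + b₂ n)) =
        (q - x) * ∑ n, v n * max 0 (u n * p + b n) +
          (x - p) * ∑ n, v n * max 0 (u n * q + b n) := by
      rw [Finset.mul_sum, Finset.mul_sum, Finset.mul_sum, ← Finset.sum_add_distrib]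
      refine Finset.sum_congr rfl fun n _ => ?_
      linear_combination v n * hin n x hx₁ hx₂
    rw [hnet]
    simp only [reluNet]
    linear_combination h

/-- Every finite set with distinct first coordinates is interpolated by some network. -/
lemma exists_reluNet_interp (S : Finset (ℝ × ℝ)) (hS : distinctX S) :
    ∃ (N : ℕ) (v u b : Fin N → ℝ) (c : ℝ), ∀ r ∈ S, reluNet N v u b c r.1 = r.2 := by
  classical
  induction S using Finset.induction_on_max_value (fun r : ℝ × ℝ => r.1) with
  | empty => exact ⟨0, 0, 0, 0, 0, by simp⟩
  | insert a s ha hmax ih =>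
    obtain ⟨N, v, u, b, c, h⟩ := ih fun r hr t ht =>
      hS r (Finset.mem_insert_of_mem hr) t (Finset.mem_insert_of_mem ht)
    obtain ⟨m, hma, hm⟩ : ∃ m < a.1, ∀ r ∈ s, r.1 ≤ m := by
      rcases s.eq_empty_or_nonempty with rfl | hs
      · exact ⟨a.1 - 1, by linarith, by simp⟩
      · obtain ⟨t, ht, hts⟩ := s.exists_max_image (fun r => r.1) hs
        refine ⟨t.1, lt_of_le_of_ne (hmax t ht) fun he => ha ?_, hts⟩
        rwa [← hS t (Finset.mem_insert_of_mem ht) a (Finset.mem_insert_self a s) he]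
    have hd : 0 < a.1 - m := sub_pos.2 hma
    refine ⟨N + 1, Fin.snoc v ((a.2 - reluNet N v u b c a.1) / (a.1 - m)), Fin.snoc u 1,
      Fin.snoc b (-m), c, ?_⟩
    have hnet : ∀ x, reluNet (N + 1) (Fin.snoc v ((a.2 - reluNet N v u b c a.1) / (a.1 - m)))
        (Fin.snoc u 1) (Fin.snoc b (-m)) c x =
        reluNet N v u b c x + (a.2 - reluNet N v u b c a.1) / (a.1 - m) * max 0 (x - m) := by
      intro x
      rw [reluNet, Fin.sum_univ_castSucc]
      simp only [Fin.snoc_castSucc, Fin.snoc_last]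
      rw [show reluNet N v u b c x = (∑ n, v n * max 0 (u n * x + b n)) + c from rfl, one_mul,
        ← sub_eq_add_neg]
      ring
    intro r hr
    rw [hnet]
    rcases Finset.mem_insert.1 hr with rfl | hr
    · rw [max_eq_right hd.le, div_mul_cancel₀ _ hd.ne']
      ring
    · rw [h r hr, max_eq_left (sub_nonpos.2 (hm r hr)), mul_zero, add_zero]

/-- Lower bound by a smaller labeled set. -/
lemma interpNorm_mono {S T : Finset (ℝ × ℝ)} (hST : S ⊆ T) (hT : distinctX T) :
    interpNorm S ≤ interpNorm T := by
  obtain ⟨N, v, u, b, c, h⟩ := exists_reluNet_interp T hT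
  refine csInf_le_csInf ⟨0, ?_⟩ ⟨_, N, v, u, b, c, h, rfl⟩ ?_
  · rintro _ ⟨N, v, u, b, c, -, rfl⟩
    exact Real.sqrt_nonneg _
  · rintro _ ⟨N, v, u, b, c, h, rfl⟩
    exact ⟨N, v, u, b, c, fun r hr => h r (hST hr), rfl⟩

/-- Adding a point on a horizontal chord between consecutive labeled points does not increase the
minimum interpolation norm. -/
lemma interpNorm_insert_le {S : Finset (ℝ × ℝ)} (hS : distinctX S) {p q y x : ℝ}
    (hp : (p, y) ∈ S) (hq : (q, y) ∈ S) (hcons : ∀ r ∈ S, ¬(p < r.1 ∧ r.1 < q))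
    (hpx : p < x) (hxq : x < q) : interpNorm (insert (x, y) S) ≤ interpNorm S := by
  obtain ⟨N, v, u, b, c, h⟩ := exists_reluNet_interp S hS
  refine le_csInf ⟨_, N, v, u, b, c, h, rfl⟩ ?_
  rintro _ ⟨N, v, u, b, c, h, rfl⟩
  have hpq := hpx.trans hxq
  obtain ⟨M, v', u', b', hw, hout, hin⟩ := exists_reluNet_chord hpq N v u b c
  refine csInf_le ⟨0, ?_⟩ ⟨M, v', u', b', c, fun r hr => ?_, hw.symm⟩
  · rintro _ ⟨N, v, u, b, c, -, rfl⟩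
    exact Real.sqrt_nonneg _
  · rcases Finset.mem_insert.1 hr with rfl | hr
    · have e := hin x hpx.le hxq.le
      rw [h _ hp, h _ hq] at e
      refine mul_left_cancel₀ (sub_pos.2 hpq).ne' (e.trans ?_)
      ring
    · rw [hout r.1 ?_, h r hr]
      by_contra! hr'
      exact hcons r hr hr'

lemma distinctX_insert {S : Finset (ℝ × ℝ)} (hS : distinctX S) {x : ℝ}
    (hx : ∀ r ∈ S, r.1 ≠ x) (y : ℝ) : distinctX (insert (x, y) S) := by
  intro r hr t ht h
  rcases Finset.mem_insert.1 hr with rfl | hr <;> rcases Finset.mem_insert.1 ht with rfl | ht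
  · rfl
  · exact absurd h.symm (hx t ht)
  · exact absurd h (hx r hr)
  · exact hS r hr t ht h

/-- For a pair of consecutive, identically labeled points `x₅ < x₆` of `ℒ`, lying strictly
between the outermost labeled points, the function-norm score is constant on `(x₅, x₆)`,
equal to the minimum interpolation norm `m(ℒ)`. -/
theorem maximin_reluNet_score_constant_same_labels (L : Finset (ℝ × ℝ))
    (hdx : distinctX L) (hlab : labelsPM L)
    (hsmall : twoSmallestEqual L) (hlarge : twoLargestEqual L)
    (x₅ x₆ y₅ y₆ : ℝ)
    (h₅ : (x₅, y₅) ∈ L) (h₆ : (x₆, y₆) ∈ L) (hlt : x₅ < x₆)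
    (hcons : ∀ r ∈ L, ¬(x₅ < r.1 ∧ r.1 < x₆))
    (hint₅ : strictlyInterior L x₅) (hint₆ : strictlyInterior L x₆)
    (hy : y₅ = y₆) :
    ∀ v : ℝ, x₅ < v → v < x₆ → scoreF L v = interpNorm L := by
  subst hy
  intro v hv₅ hv₆
  have hv : ∀ r ∈ L, r.1 ≠ v := fun r hr h => hcons r hr (h ▸ ⟨hv₅, hv₆⟩)
  have hge : ∀ y, interpNorm L ≤ interpNorm (insert (v, y) L) := fun y =>
    interpNorm_mono (Finset.subset_insert _ _) (distinctX_insert hdx hv y)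
  have hle := interpNorm_insert_le hdx h₅ h₆ hcons hv₅ hv₆
  refine le_antisymm ?_ (le_min (hge _) (hge _))
  rcases hlab _ h₅ with h | h <;> dsimp only at h <;> subst h
  · exact (min_le_left _ _).trans hle
  · exact (min_le_right _ _).trans hle
end

section
/- Let x₁ < x₂ be real numbers with labels y₁, y₂ ∈ {−1,+1}, y₁ ≠ y₂. Let f : [x₁,x₂] → ℝ be the affine function with f(x₁) = y₁ and f(x₂) = y₂. For x₁ < u < x₂ define f^u : [x₁,x₂] → ℝ as follows: if u ≤; (x₁+x₂)/2 then f^u equals y₁ on [x₁,u] and is affine from (u,y₁) to (x₂,y₂) on [u,x₂]; if u > (x₁+x₂)/2 then f^u is affine from (x₁,y₁) to (u,y₂) on [x₁,u] and equals y₂ on [u,x₂]. Then the map g(u) := ∫_{x₁}^{x₂} (f^u(x) − f(x))² dx is nondecreasing on (x₁, (x₁+x₂)/2] and nonincreasing on [(x₁+x₂)/2, x₂); consequently g(u) ≤ g((x₁+x₂)/2) for all u ∈ (x₁,x₂). -/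
open MeasureTheory

/-- The squared integral of a function that is linear on each side of `u` and vanishes at the
endpoints `a` and `b`. -/
lemma integral_sq_piecewise_linear {a b u p q : ℝ} (hau : a ≤ u) (hub : u ≤ b) {h : ℝ → ℝ}
    (hl : ∀ x, x ≤ u → h x = p * (x - a)) (hr : ∀ x, u < x → h x = q * (x - b)) :
    ∫ x in a..b, h x ^ 2 = p ^ 2 * (u - a) ^ 3 / 3 + q ^ 2 * (b - u) ^ 3 / 3 := by
  have key (s t k c : ℝ) : ∫ x in s..t, (k * (x - c)) ^ 2 =
      k ^ 2 * (((t - c) ^ 3 - (s - c) ^ 3) / 3) := by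
    simp only [mul_pow]
    rw [intervalIntegral.integral_const_mul,
      intervalIntegral.integral_comp_sub_right (fun x : ℝ => x ^ 2), integral_pow]
    norm_num
  have el : Set.EqOn (fun x => (p * (x - a)) ^ 2) (fun x => h x ^ 2) (Set.uIoc a u) := by
    intro x hx
    rw [Set.uIoc_of_le hau] at hx
    simp only [hl x hx.2]
  have er : Set.EqOn (fun x => (q * (x - b)) ^ 2) (fun x => h x ^ 2) (Set.uIoc u b) := by
    intro x hx
    rw [Set.uIoc_of_le hub] at hx
    simp only [hr x hx.1]
  have il : IntervalIntegrable (fun x => h x ^ 2) volume a u :=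
    (Continuous.intervalIntegrable (by fun_prop) a u).congr el
  have ir : IntervalIntegrable (fun x => h x ^ 2) volume u b :=
    (Continuous.intervalIntegrable (by fun_prop) u b).congr er
  rw [← intervalIntegral.integral_add_adjacent_intervals il ir,
    ← intervalIntegral.integral_congr_ae (ae_of_all _ el), ← intervalIntegral.integral_congr_ae (ae_of_all _ er),
    key, key]
  ring

/-- For consecutive oppositely labeled points, the data-based score
`g(u) = ∫_{x₁}^{x₂} (f^u − f)²` is nondecreasing up to the midpoint, nonincreasing after the
midpoint, and hence maximized at the midpoint. Here `f` is the affine interpolant of the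
endpoint labels and `f^u` is the minimal-knot spline obtained by adding `u` with the label of
the nearer endpoint. -/
theorem databased_score_midpoint_max (x₁ x₂ y₁ y₂ : ℝ) (hx : x₁ < x₂)
    (hy₁ : y₁ = 1 ∨ y₁ = -1) (hy₂ : y₂ = 1 ∨ y₂ = -1) (hne : y₁ ≠ y₂)
    (f : ℝ → ℝ) (hf : ∀ x, f x = y₁ + (y₂ - y₁) * (x - x₁) / (x₂ - x₁))
    (fu : ℝ → ℝ → ℝ)
    (hfu : ∀ u x, fu u x =
      if u ≤ (x₁ + x₂) / 2 then
        (if x ≤ u then y₁ else y₁ + (y₂ - y₁) * (x - u) / (x₂ - u))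
      else
        (if x ≤ u then y₁ + (y₂ - y₁) * (x - x₁) / (u - x₁) else y₂))
    (g : ℝ → ℝ) (hg : ∀ u, g u = ∫ x in x₁..x₂, (fu u x - f x) ^ 2) :
    MonotoneOn g (Set.Ioc x₁ ((x₁ + x₂) / 2)) ∧
    AntitoneOn g (Set.Ico ((x₁ + x₂) / 2) x₂) ∧
    ∀ u : ℝ, x₁ < u → u < x₂ → g u ≤ g ((x₁ + x₂) / 2) := by
  have hL : 0 < x₂ - x₁ := sub_pos.2 hx
  have gl : ∀ u, x₁ < u → u ≤ (x₁ + x₂) / 2 →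
      g u = (y₂ - y₁) ^ 2 / (3 * (x₂ - x₁)) * (u - x₁) ^ 2 := by
    intro u h1 h2
    have hu : 0 < x₂ - u := by linarith
    rw [hg, integral_sq_piecewise_linear (p := -(y₂ - y₁) / (x₂ - x₁))
      (q := (y₂ - y₁) * (u - x₁) / ((x₂ - x₁) * (x₂ - u))) h1.le (by linarith)]
    · field_simp
      ring
    · intro x hxu
      rw [hfu, hf, if_pos h2, if_pos hxu]
      ring
    · intro x hxu
      rw [hfu, hf, if_pos h2, if_neg hxu.not_ge]
      field_simp
      ring
  have gr : ∀ u, (x₁ + x₂) / 2 ≤ u → u < x₂ →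
      g u = (y₂ - y₁) ^ 2 / (3 * (x₂ - x₁)) * (x₂ - u) ^ 2 := by
    intro u h1 h2
    rcases h1.eq_or_lt with rfl | h1
    · rw [gl _ (by linarith) le_rfl]
      ring
    have hu : 0 < u - x₁ := by linarith
    rw [hg, integral_sq_piecewise_linear
      (p := (y₂ - y₁) * (x₂ - u) / ((x₂ - x₁) * (u - x₁)))
      (q := -(y₂ - y₁) / (x₂ - x₁)) (by linarith) h2.le]
    · field_simp
      ring
    · intro x hxu
      rw [hfu, hf, if_neg h1.not_ge, if_pos hxu]
      field_simp
      ring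
    · intro x hxu
      rw [hfu, hf, if_neg h1.not_ge, if_neg hxu.not_ge]
      field_simp
      ring
  have hmono : MonotoneOn g (Set.Ioc x₁ ((x₁ + x₂) / 2)) := by
    intro u hu v hv huv
    have := sub_pos.2 hu.1
    rw [gl u hu.1 hu.2, gl v hv.1 hv.2]
    gcongr
  have hanti : AntitoneOn g (Set.Ico ((x₁ + x₂) / 2) x₂) := by
    intro u hu v hv huv
    have := sub_pos.2 hv.2
    rw [gr u hu.1 hu.2, gr v hv.1 hv.2]
    gcongr
  refine ⟨hmono, hanti, fun u h1 h2 => ?_⟩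
  rcases le_total u ((x₁ + x₂) / 2) with h | h
  · exact hmono ⟨h1, h⟩ ⟨by linarith, le_rfl⟩ h
  · exact hanti ⟨le_rfl, by linarith⟩ ⟨h, h2⟩ h
end

section
/- Let x₁ < x₂ and x₃ < x₄ be two disjoint pairs of real numbers, each pair carrying opposite labels in {−1,+1}, with x₂ − x₁ ≥ x₄ − x₃. For each pair, let f be the affine interpolant of the endpoint labels on the interval, let m be the midpoint of the interval, and let f^m be the minimal-knot linear spline obtained by additionally interpolating the value ε ∈ {−1,+1} at m (either choice of ε yields the same integral below by symmetry). Then ∫_{x₁}^{x₂} (f^m(x) − f(x))² dx for the pair (x₁,x₂) is greater than or equal to the corresponding integral ∫_{x₃}^{x₄} (f^{m'}(x) − f(x))² dx for the pair (x₃,x₄); i.e., with points uniformly distributed, the data-based score at the midpoint is larger for the longer oppositely-labeled interval. -/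
open MeasureTheory

/-- The data-based score at the midpoint of an oppositely labeled interval `[a,b]`:
`∫_a^b (f^m − f)²` where `f` is the affine interpolant of `(a, ya), (b, yb)` and `f^m`
is the minimal-knot spline additionally interpolating the value `ya` at the midpoint
`m = (a+b)/2` (by symmetry, either label choice at `m` yields the same value). -/
noncomputable def midScore (a b ya yb : ℝ) : ℝ :=
  ∫ x in a..b,
    ((if x ≤ (a + b) / 2 then ya
      else ya + (yb - ya) * (x - (a + b) / 2) / (b - (a + b) / 2))
      - (ya + (yb - ya) * (x - a) / (b - a))) ^ 2

/-- The midpoint score is proportional to the length of the interval. -/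
theorem midScore_eq {a b : ℝ} (hab : a < b) (ya yb : ℝ) :
    midScore a b ya yb = (yb - ya) ^ 2 * (b - a) / 12 := by
  have hL : b - a ≠ 0 := (sub_pos.2 hab).ne'
  set g : ℝ → ℝ := fun x => ((if x ≤ (a + b) / 2 then ya
      else ya + (yb - ya) * (x - (a + b) / 2) / (b - (a + b) / 2))
      - (ya + (yb - ya) * (x - a) / (b - a))) ^ 2 with hg
  set c : ℝ := ((yb - ya) / (b - a)) ^ 2 with hc
  have left : Set.EqOn (fun x => c * (x - a) ^ 2) g (Set.uIoc a ((a + b) / 2)) := by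
    intro x hx
    rw [Set.uIoc_of_le (by linarith)] at hx
    simp only [hg, hc, if_pos hx.2]
    ring
  have right : Set.EqOn (fun x => c * (x - b) ^ 2) g (Set.uIoc ((a + b) / 2) b) := by
    intro x hx
    rw [Set.uIoc_of_le (by linarith)] at hx
    simp only [hg, hc, if_neg (not_le.2 hx.1)]
    rw [show b - (a + b) / 2 = (b - a) / 2 by ring]
    field_simp
    ring
  have integrable_left : IntervalIntegrable g volume a ((a + b) / 2) :=
    (Continuous.intervalIntegrable (by fun_prop) _ _).congr left
  have integrable_right : IntervalIntegrable g volume ((a + b) / 2) b :=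
    (Continuous.intervalIntegrable (by fun_prop) _ _).congr right
  have integral_sq (p q r : ℝ) :
      ∫ x in p..q, c * (x - r) ^ 2 = c * (((q - r) ^ 3 - (p - r) ^ 3) / 3) := by
    rw [intervalIntegral.integral_const_mul,
      intervalIntegral.integral_comp_sub_right (fun x => x ^ 2), integral_pow]
    norm_num
  change ∫ x in a..b, g x = _
  rw [← intervalIntegral.integral_add_adjacent_intervals integrable_left integrable_right,
    ← intervalIntegral.integral_congr_uIoo (left.mono Set.Ioo_subset_Ioc_self),
    ← intervalIntegral.integral_congr_uIoo (right.mono Set.Ioo_subset_Ioc_self),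
    integral_sq, integral_sq, hc]
  field_simp
  ring

/-- With points uniformly distributed, the data-based score at the midpoint is larger for the
longer oppositely labeled interval. -/
theorem databased_midpoint_score_longer_interval
    (x₁ x₂ x₃ x₄ y₁ y₂ y₃ y₄ : ℝ)
    (h12 : x₁ < x₂) (h34 : x₃ < x₄)
    (hdisj : ({x₁, x₂} : Set ℝ) ∩ {x₃, x₄} = ∅)
    (hy₁ : y₁ = 1 ∨ y₁ = -1) (hy₂ : y₂ = 1 ∨ y₂ = -1) (hne12 : y₁ ≠ y₂)
    (hy₃ : y₃ = 1 ∨ y₃ = -1) (hy₄ : y₄ = 1 ∨ y₄ = -1) (hne34 : y₃ ≠ y₄)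
    (hlen : x₄ - x₃ ≤ x₂ - x₁) :
    midScore x₃ x₄ y₃ y₄ ≤ midScore x₁ x₂ y₁ y₂ := by
  have sq_sub {u v : ℝ} (hu : u = 1 ∨ u = -1) (hv : v = 1 ∨ v = -1) (huv : u ≠ v) :
      (v - u) ^ 2 = 4 := by
    rcases hu with rfl | rfl <;> rcases hv with rfl | rfl <;> first
      | exact absurd rfl huv
      | norm_num
  rw [midScore_eq h12, midScore_eq h34, sq_sub hy₁ hy₂ hne12, sq_sub hy₃ hy₄ hne34]
  linarith
end

section
/- Let ℒ be a finite labeled set in ℝ×{−1,+1} and let x₅ < x₆ be consecutive labeled points of ℒ with equal labels y₅ = y₆. Let f be the minimal-knot linear spline interpolant of ℒ. For any v with x₅ < v < x₆, adding v with the label ε(v) = y₅ (the label minimizing the total variation of the derivative of the interpolant) leaves the interpolant unchanged: f^v = f, and hence the data-based score score_D(v) = ∫ (f^v(x) − f(x))² dx = 0; in particular score_D(v) ≤ score_D(u) for every u lying between a pair of consecutive oppositely labeled points. -/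
open MeasureTheory

/-- `f` is the minimal-knot linear spline interpolant of the finite labeled set `L`:
it interpolates the data, is affine between consecutive labeled points, and is constant
to the left of the smallest and to the right of the largest labeled point. -/
def IsMinKnotSpline (L : Finset (ℝ × ℝ)) (f : ℝ → ℝ) : Prop :=
  (∀ p ∈ L, f p.1 = p.2) ∧
  (∀ p ∈ L, ∀ q ∈ L, p.1 < q.1 → (∀ r ∈ L, ¬(p.1 < r.1 ∧ r.1 < q.1)) →
    ∀ x : ℝ, p.1 ≤ x → x ≤ q.1 → f x = p.2 + (q.2 - p.2) * (x - p.1) / (q.1 - p.1)) ∧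
  (∀ p ∈ L, (∀ q ∈ L, p.1 ≤ q.1) → ∀ x : ℝ, x ≤ p.1 → f x = p.2) ∧
  (∀ p ∈ L, (∀ q ∈ L, q.1 ≤ p.1) → ∀ x : ℝ, p.1 ≤ x → f x = p.2)

/-- A real number is left of all points of `L`, right of all of them, or between two
consecutive ones. -/
theorem exists_consecutive_or_extreme (L : Finset (ℝ × ℝ)) (hL : L.Nonempty) (x : ℝ) :
    (∃ p ∈ L, (∀ q ∈ L, p.1 ≤ q.1) ∧ x ≤ p.1) ∨
    (∃ p ∈ L, (∀ q ∈ L, q.1 ≤ p.1) ∧ p.1 ≤ x) ∨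
    (∃ p ∈ L, ∃ q ∈ L, p.1 < q.1 ∧ (∀ r ∈ L, ¬(p.1 < r.1 ∧ r.1 < q.1)) ∧
      p.1 ≤ x ∧ x ≤ q.1) := by
  by_cases hA : (L.filter (fun r => r.1 ≤ x)).Nonempty
  · by_cases hB : (L.filter (fun r => x < r.1)).Nonempty
    · obtain ⟨p, hp, hpmax⟩ := Finset.exists_max_image _ (fun r : ℝ × ℝ => r.1) hA
      obtain ⟨q, hq, hqmin⟩ := Finset.exists_min_image _ (fun r : ℝ × ℝ => r.1) hB
      simp only [Finset.mem_filter, and_imp] at hp hq hpmax hqmin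
      refine .inr (.inr ⟨p, hp.1, q, hq.1, hp.2.trans_lt hq.2, ?_, hp.2, hq.2.le⟩)
      rintro r hr ⟨h1, h2⟩
      rcases le_or_gt r.1 x with h | h
      · exact absurd (hpmax r hr h) h1.not_ge
      · exact absurd (hqmin r hr h) h2.not_ge
    · obtain ⟨p, hp, hpmax⟩ := Finset.exists_max_image _ (fun r : ℝ × ℝ => r.1) hL
      refine .inr (.inl ⟨p, hp, hpmax, ?_⟩)
      by_contra h
      exact hB ⟨p, Finset.mem_filter.2 ⟨hp, not_le.1 h⟩⟩
  · obtain ⟨p, hp, hpmin⟩ := Finset.exists_min_image _ (fun r : ℝ × ℝ => r.1) hL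
    refine .inl ⟨p, hp, hpmin, ?_⟩
    by_contra h
    exact hA ⟨p, Finset.mem_filter.2 ⟨hp, (not_le.1 h).le⟩⟩

/-- Inserting a point with the common label between two consecutive equally labeled points does
not change the minimal-knot spline interpolant. -/
theorem IsMinKnotSpline.eq_of_insert_between {L : Finset (ℝ × ℝ)} (hdx : distinctX L)
    {a b y v : ℝ} (ha : (a, y) ∈ L) (hb : (b, y) ∈ L)
    (hcons : ∀ r ∈ L, ¬(a < r.1 ∧ r.1 < b)) (hav : a < v) (hvb : v < b)
    {f g : ℝ → ℝ} (hf : IsMinKnotSpline L f) (hg : IsMinKnotSpline (insert (v, y) L) g) :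
    g = f := by
  obtain ⟨-, hf_mid, hf_left, hf_right⟩ := hf
  obtain ⟨-, hg_mid, hg_left, hg_right⟩ := hg
  have hsub : ∀ {p}, p ∈ L → p ∈ insert (v, y) L := fun h => Finset.mem_insert_of_mem h
  have hv : (v, y) ∈ insert (v, y) L := Finset.mem_insert_self _ _
  funext x
  rcases exists_consecutive_or_extreme L ⟨_, ha⟩ x with
    ⟨p, hp, hmin, hx⟩ | ⟨p, hp, hmax, hx⟩ | ⟨p, hp, q, hq, hpq, hc, hx1, hx2⟩
  · rw [hf_left p hp hmin x hx, hg_left p (hsub hp) ?_ x hx]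
    exact Finset.forall_mem_insert _ _ _ |>.2 ⟨(hmin _ ha).trans hav.le, hmin⟩
  · rw [hf_right p hp hmax x hx, hg_right p (hsub hp) ?_ x hx]
    exact Finset.forall_mem_insert _ _ _ |>.2 ⟨hvb.le.trans (hmax _ hb), hmax⟩
  · by_cases hvpq : p.1 < v ∧ v < q.1
    · have hpa : p = (a, y) := by
        refine hdx _ hp _ ha (le_antisymm ?_ ?_)
        · exact not_lt.1 fun h => hcons p hp ⟨h, hvpq.1.trans hvb⟩
        · exact not_lt.1 fun h => hc _ ha ⟨h, hav.trans hvpq.2⟩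
      have hqb : q = (b, y) := by
        refine hdx _ hq _ hb (le_antisymm ?_ ?_)
        · exact not_lt.1 fun h => hc _ hb ⟨hvpq.1.trans hvb, h⟩
        · exact not_lt.1 fun h => hcons q hq ⟨hav.trans hvpq.2, h⟩
      subst hpa hqb
      rw [hf_mid _ hp _ hq hpq hc x hx1 hx2]
      rcases le_total x v with h | h
      · rw [hg_mid _ (hsub hp) _ hv hav ?_ x hx1 h]
        · simp
        · exact Finset.forall_mem_insert _ _ _ |>.2
            ⟨fun h => lt_irrefl _ h.2, fun r hr h => hc r hr ⟨h.1, h.2.trans hvb⟩⟩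
      · rw [hg_mid _ hv _ (hsub hq) hvb ?_ x h hx2]
        · simp
        · exact Finset.forall_mem_insert _ _ _ |>.2
            ⟨fun h => lt_irrefl _ h.1, fun r hr h => hc r hr ⟨hav.trans h.1, h.2⟩⟩
    · rw [hf_mid p hp q hq hpq hc x hx1 hx2, hg_mid p (hsub hp) q (hsub hq) hpq ?_ x hx1 hx2]
      exact Finset.forall_mem_insert _ _ _ |>.2 ⟨hvpq, hc⟩

/-- Adding a point `v` between two consecutive identically labeled points `x₅ < x₆` of `ℒ`,
with the label `y₅` (the label minimizing the total variation of the derivative), leaves the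
minimal-knot spline interpolant unchanged, so its data-based score is `0`; in particular it is
at most the score of any point between a pair of consecutive oppositely labeled points. -/
theorem databased_score_zero_same_labels (L : Finset (ℝ × ℝ))
    (hdx : distinctX L) (hlab : labelsPM L)
    (x₅ x₆ y₅ y₆ : ℝ) (h₅ : (x₅, y₅) ∈ L) (h₆ : (x₆, y₆) ∈ L) (h56 : x₅ < x₆)
    (hcons : ∀ r ∈ L, ¬(x₅ < r.1 ∧ r.1 < x₆)) (hyeq : y₅ = y₆)
    (f : ℝ → ℝ) (hf : IsMinKnotSpline L f)
    (v : ℝ) (hv₁ : x₅ < v) (hv₂ : v < x₆)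
    (fv : ℝ → ℝ) (hfv : IsMinKnotSpline (insert (v, y₅) L) fv) :
    fv = f ∧ (∫ x : ℝ, (fv x - f x) ^ 2) = 0 ∧
    (∀ a b ya yb : ℝ, (a, ya) ∈ L → (b, yb) ∈ L → a < b →
      (∀ r ∈ L, ¬(a < r.1 ∧ r.1 < b)) → ya ≠ yb →
      ∀ u : ℝ, a < u → u < b → ∀ ε : ℝ, (ε = 1 ∨ ε = -1) →
      ∀ fu : ℝ → ℝ, IsMinKnotSpline (insert (u, ε) L) fu →
      (∫ x : ℝ, (fv x - f x) ^ 2) ≤ ∫ x : ℝ, (fu x - f x) ^ 2) := by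
  subst hyeq
  obtain rfl := hf.eq_of_insert_between hdx h₅ h₆ hcons hv₁ hv₂ hfv
  have hzero : (∫ x : ℝ, (fv x - fv x) ^ 2) = 0 := by simp
  refine ⟨rfl, hzero, ?_⟩
  intros
  rw [hzero]
  exact integral_nonneg fun x => sq_nonneg _
end

section
/- Fix h > 0 and points x₁ < x₂ < … < x_n in ℝ. Let K be the n×n matrix with K_{ij} = exp(−|x_i − x_j|/h). Define d_i = exp(−(x_{i+1} − x_i)/h) for 1 ≤ i ≤ n−1 and set d₀ = d_n = 0. Then K is invertible and its inverse M = K⁻¹ is tridiagonal with entries M_{ii} = 1/(1 − d_{i−1}²) + 1/(1 − d_i²) − 1 for 1 ≤ i ≤ n, M_{i,i+1} = M_{i+1,i} = −d_i/(1 − d_i²) for 1 ≤ i ≤ n−1, and M_{ij} = 0 whenever |i − j| ≥ 2. -/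
open Matrix

namespace LaplaceKernel

/-- The tridiagonal inverse of the Laplace kernel matrix with gap factors `D`. -/
noncomputable def tridiagonal (n : ℕ) (D : ℕ → ℝ) : Matrix (Fin n) (Fin n) ℝ := fun i j =>
  if i.val = j.val then 1 / (1 - D j.val ^ 2) + 1 / (1 - D (j.val + 1) ^ 2) - 1
  else if i.val + 1 = j.val then -D j.val / (1 - D j.val ^ 2)
  else if i.val = j.val + 1 then -D (j.val + 1) / (1 - D (j.val + 1) ^ 2)
  else 0

lemma sum_mul_ite_val_eq {R : Type*} [NonUnitalNonAssocSemiring R] {n : ℕ} (f : Fin n → R)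
    (m : Fin n) (c : R) : ∑ l, f l * (if l.val = m.val then c else 0) = f m * c := by
  simp [← Fin.ext_iff]

lemma sum_mul_ite_val_succ_eq {R : Type*} [NonUnitalNonAssocSemiring R] {n : ℕ}
    (f : Fin n → R) (j : Fin n) (c : R) :
    ∑ l, f l * (if l.val + 1 = j.val then c else 0) =
      if hj : 1 ≤ j.val then f ⟨j.val - 1, by omega⟩ * c else 0 := by
  split_ifs with hj
  · rw [← sum_mul_ite_val_eq f ⟨j.val - 1, by omega⟩ c]
    refine Finset.sum_congr rfl fun l _ => ?_
    congr 1
    exact if_congr (by simp only; omega) rfl rfl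
  · refine Finset.sum_eq_zero fun l _ => ?_
    rw [if_neg (by omega), mul_zero]

lemma sum_mul_ite_val_eq_succ {R : Type*} [NonUnitalNonAssocSemiring R] {n : ℕ}
    (f : Fin n → R) (j : Fin n) (c : R) :
    ∑ l, f l * (if l.val = j.val + 1 then c else 0) =
      if hj : j.val + 1 < n then f ⟨j.val + 1, hj⟩ * c else 0 := by
  split_ifs with hj
  · exact sum_mul_ite_val_eq f ⟨j.val + 1, hj⟩ c
  · refine Finset.sum_eq_zero fun l _ => ?_
    rw [if_neg (by omega), mul_zero]

/-- A matrix whose entries are multiplied by `D` when moving one step away from the diagonal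
has the tridiagonal matrix as a right inverse. -/
lemma mul_tridiagonal {n : ℕ} {D : ℕ → ℝ} {K : Matrix (Fin n) (Fin n) ℝ}
    (hdiag : ∀ i, K i i = 1)
    (hright : ∀ i l r : Fin n, l.val + 1 = r.val → i ≤ l → K i r = K i l * D r.val)
    (hleft : ∀ i l r : Fin n, l.val + 1 = r.val → r ≤ i → K i l = K i r * D r.val)
    (hD0 : D 0 = 0) (hDn : D n = 0) (hD : ∀ k, D k ^ 2 ≠ 1) :
    K * tridiagonal n D = 1 := by
  ext i j
  have hsplit : ∀ l, K i l * tridiagonal n D l j =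
      K i l * (if l.val = j.val then
        1 / (1 - D j.val ^ 2) + 1 / (1 - D (j.val + 1) ^ 2) - 1 else 0) +
      K i l * (if l.val + 1 = j.val then -D j.val / (1 - D j.val ^ 2) else 0) +
      K i l * (if l.val = j.val + 1 then
        -D (j.val + 1) / (1 - D (j.val + 1) ^ 2) else 0) := by
    intro l
    simp only [tridiagonal]
    split_ifs <;> first | omega | ring
  have h1 : 1 - D j.val ^ 2 ≠ 0 := sub_ne_zero.2 (hD _).symm
  have h2 : 1 - D (j.val + 1) ^ 2 ≠ 0 := sub_ne_zero.2 (hD _).symm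
  have hl : (if hj : 1 ≤ j.val then
        K i ⟨j.val - 1, by omega⟩ * (-D j.val / (1 - D j.val ^ 2)) else 0) =
      -(K i j * (if i < j then 1 else D j.val ^ 2)) / (1 - D j.val ^ 2) := by
    by_cases hj : 1 ≤ j.val
    · rw [dif_pos hj]
      split_ifs with hij
      · rw [hright i ⟨j.val - 1, by omega⟩ j (by simp only; omega)
          (by rw [Fin.le_def]; simp only; omega)]
        ring
      · rw [hleft i ⟨j.val - 1, by omega⟩ j (by simp only; omega) (not_lt.1 hij)]
        ring
    · rw [dif_neg hj, if_neg (by omega), show j.val = 0 by omega, hD0]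
      simp
  have hr : (if hj : j.val + 1 < n then
        K i ⟨j.val + 1, hj⟩ * (-D (j.val + 1) / (1 - D (j.val + 1) ^ 2)) else 0) =
      -(K i j * (if j < i then 1 else D (j.val + 1) ^ 2)) / (1 - D (j.val + 1) ^ 2) := by
    by_cases hj : j.val + 1 < n
    · rw [dif_pos hj]
      split_ifs with hij
      · rw [hleft i j ⟨j.val + 1, hj⟩ rfl (by rw [Fin.le_def]; simp only; omega)]
        ring
      · rw [hright i j ⟨j.val + 1, hj⟩ rfl (not_lt.1 hij)]
        ring
    · rw [dif_neg hj, if_neg (by omega), show j.val + 1 = n by omega, hDn]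
      simp
  rw [Matrix.mul_apply, Finset.sum_congr rfl fun l _ => hsplit l, Finset.sum_add_distrib,
    Finset.sum_add_distrib, sum_mul_ite_val_eq, sum_mul_ite_val_succ_eq,
    sum_mul_ite_val_eq_succ, hl, hr]
  rcases lt_trichotomy i j with hij | rfl | hij
  · rw [if_pos hij, if_neg hij.not_gt, Matrix.one_apply_ne hij.ne]
    field_simp
    ring
  · rw [if_neg (lt_irrefl _), if_neg (lt_irrefl _), hdiag, Matrix.one_apply_eq]
    field_simp
    ring
  · rw [if_neg hij.not_gt, if_pos hij, Matrix.one_apply_ne hij.ne']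
    field_simp
    ring

end LaplaceKernel

/-- The inverse of the Laplace-kernel matrix of points `x₀ < x₁ < … < x_{n-1}` is tridiagonal,
with entries expressed via the quantities `D k = exp(−(x_k − x_{k−1})/h)` for `1 ≤ k ≤ n−1`
(and `D k = 0` otherwise, encoding the boundary conventions `d₀ = d_n = 0`). -/
theorem laplace_kernel_matrix_inverse_tridiagonal (n : ℕ) (hn : 1 ≤ n)
    (h : ℝ) (hh : 0 < h) (x : Fin n → ℝ) (hx : StrictMono x)
    (K : Matrix (Fin n) (Fin n) ℝ)
    (hK : ∀ i j, K i j = Real.exp (-|x i - x j| / h))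
    (D : ℕ → ℝ)
    (hD : ∀ k : ℕ, D k = if hk : 1 ≤ k ∧ k < n
      then Real.exp (-(x ⟨k, hk.2⟩ - x ⟨k - 1, by omega⟩) / h) else 0) :
    IsUnit K.det ∧
    (∀ i : Fin n,
      K⁻¹ i i = 1 / (1 - (D i.val) ^ 2) + 1 / (1 - (D (i.val + 1)) ^ 2) - 1) ∧
    (∀ i j : Fin n, j.val = i.val + 1 →
      K⁻¹ i j = -(D (i.val + 1)) / (1 - (D (i.val + 1)) ^ 2) ∧
      K⁻¹ j i = -(D (i.val + 1)) / (1 - (D (i.val + 1)) ^ 2)) ∧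
    (∀ i j : Fin n, 2 ≤ |(i.val : ℤ) - (j.val : ℤ)| → K⁻¹ i j = 0) := by
  have hDgap : ∀ l r : Fin n, l.val + 1 = r.val → D r.val = Real.exp (-(x r - x l) / h) := by
    intro l r hlr
    rw [hD, dif_pos ⟨by omega, r.isLt⟩]
    have hl : (⟨r.val - 1, by omega⟩ : Fin n) = l := Fin.ext (by simp only; omega)
    rw [hl]
  have hD1 : ∀ k, D k ^ 2 ≠ 1 := by
    intro k
    refine (pow_lt_one₀ ?_ ?_ two_ne_zero).ne <;> rw [hD] <;> split_ifs with hk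
    · positivity
    · exact le_rfl
    · have hlt : x ⟨k - 1, by omega⟩ < x ⟨k, hk.2⟩ := hx (by rw [Fin.lt_def]; simp only; omega)
      exact Real.exp_lt_one_iff.2 (div_neg_of_neg_of_pos (by linarith) hh)
    · exact one_pos
  have hmul : K * LaplaceKernel.tridiagonal n D = 1 := by
    refine LaplaceKernel.mul_tridiagonal ?_ ?_ ?_ ?_ ?_ hD1
    · intro i
      simp [hK]
    · intro i l r hlr hil
      have hlr' : l ≤ r := by rw [Fin.le_def]; omega
      have h1 := hx.monotone hil
      have h2 := hx.monotone hlr'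
      rw [hK, hK, hDgap l r hlr, ← Real.exp_add, abs_of_nonpos (by linarith),
        abs_of_nonpos (by linarith)]
      ring_nf
    · intro i l r hlr hri
      have hlr' : l ≤ r := by rw [Fin.le_def]; omega
      have h1 := hx.monotone hri
      have h2 := hx.monotone hlr'
      rw [hK, hK, hDgap l r hlr, ← Real.exp_add, abs_of_nonneg (by linarith),
        abs_of_nonneg (by linarith)]
      ring_nf
    · simp [hD]
    · simp [hD]
  rw [Matrix.inv_eq_right_inv hmul]
  refine ⟨Matrix.isUnit_det_of_right_inverse hmul, fun i => ?_, fun i j hij => ⟨?_, ?_⟩,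
    fun i j hij => ?_⟩
  · simp [LaplaceKernel.tridiagonal]
  · simp [LaplaceKernel.tridiagonal, hij]
  · simp only [LaplaceKernel.tridiagonal]
    rw [if_neg (by omega), if_neg (by omega), if_pos hij]
  · have hij' := le_abs.1 hij
    simp only [LaplaceKernel.tridiagonal]
    rw [if_neg (by omega), if_neg (by omega), if_neg (by omega)]
end

section
/- Fix h > 0, points x₁ < x₂ < … < x_n in ℝ (n ≥ 1), and labels y ∈ {−1,+1}ⁿ. Let K be the n×n matrix with K_{ij} = exp(−|x_i − x_j|/h). Then K is invertible and the quadratic form satisfies yᵀ K⁻¹ y = −(n − 2) + 2·Σ_{i=1}^{n−1} 1/(1 + y_i·y_{i+1}·exp(−(x_{i+1} − x_i)/h)). -/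
open Matrix

/-- The Laplace kernel system is solvable for every right-hand side `y`, with a solution `a` for
which `y ⬝ᵥ a` is an explicit sum over consecutive pairs of points. -/
lemma exists_laplace_kernel_solution {h : ℝ} (hh : 0 < h) (n : ℕ)
    (x : Fin (n + 1) → ℝ) (hx : StrictMono x) (y : Fin (n + 1) → ℝ) :
    ∃ a : Fin (n + 1) → ℝ,
      (∀ i, ∑ j, Real.exp (-|x i - x j| / h) * a j = y i) ∧
      ∑ i, y i * a i = y (Fin.last n) ^ 2 + ∑ i : Fin n,
        (y i.castSucc - Real.exp (-(x i.succ - x i.castSucc) / h) * y i.succ) ^ 2 /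
          (1 - Real.exp (-(x i.succ - x i.castSucc) / h) ^ 2) := by
  induction n with
  | zero => exact ⟨y, fun i => by
      obtain rfl : i = 0 := Fin.fin_one_eq_zero i
      simp, by simp [sq]⟩
  | succ n ih =>
    obtain ⟨b, hb, hq⟩ := ih (fun i => x i.succ)
      (hx.comp (Fin.strictMono_succ)) (fun i => y i.succ)
    set r := Real.exp (-(x 1 - x 0) / h) with hr
    have h01 : x 0 < x 1 := hx (by simp)
    have hr0 : 0 < r := Real.exp_pos _
    have hr1 : r < 1 := by
      rw [hr, Real.exp_lt_one_iff]
      exact div_neg_of_neg_of_pos (by linarith) hh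
    have hne : 1 - r ^ 2 ≠ 0 := by nlinarith
    have hv : ∀ j : Fin (n + 1), Real.exp (-|x 0 - x j.succ| / h) =
        r * Real.exp (-|x (Fin.succ 0) - x j.succ| / h) := by
      intro j
      have h1 : x 0 ≤ x j.succ := hx.monotone (Fin.zero_le _)
      have h2 : x (Fin.succ 0) ≤ x j.succ :=
        hx.monotone (Fin.succ_le_succ_iff.2 (Fin.zero_le _))
      rw [hr, ← Real.exp_add, abs_of_nonpos (by linarith), abs_of_nonpos (by linarith),
        Fin.succ_zero_eq_one]
      congr 1
      ring
    set c := (y 0 - r * y 1) / (1 - r ^ 2) with hc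
    have hcr : c * (1 - r ^ 2) = y 0 - r * y 1 := div_mul_cancel₀ _ hne
    refine ⟨Fin.cons c (fun j => b j - if j = 0 then c * r else 0), ?_, ?_⟩
    · intro i
      rw [Fin.sum_univ_succ]
      simp only [Fin.cons_zero, Fin.cons_succ, mul_sub, Finset.sum_sub_distrib, mul_ite, mul_zero,
        Finset.sum_ite_eq', Finset.mem_univ, if_true]
      refine Fin.cases ?_ (fun i => ?_) i
      · have h0 := hb 0
        simp only [hv, mul_assoc, ← Finset.mul_sum, h0]
        simp
        linear_combination hcr
      · rw [hb i, abs_sub_comm, hv i, abs_sub_comm]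
        ring
    · conv_lhs => rw [Fin.sum_univ_succ]
      conv_rhs => rw [Fin.sum_univ_succ]
      simp only [Fin.cons_zero, Fin.cons_succ, mul_sub, Finset.sum_sub_distrib, mul_ite, mul_zero,
        Finset.sum_ite_eq', Finset.mem_univ, if_true, hq, Fin.succ_last, Fin.castSucc_zero,
        Fin.succ_zero_eq_one, Fin.castSucc_succ, ← hr]
      have : (y 0 - r * y 1) ^ 2 / (1 - r ^ 2) = c * (y 0 - r * y 1) := by rw [hc]; ring
      rw [this]
      ring

/-- For `n+1` increasing points with ±1 labels `y`, the Laplace-kernel matrix `K` is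
invertible and the quadratic form satisfies
`yᵀ K⁻¹ y = −((n+1) − 2) + 2 ∑_{i} 1/(1 + y_i y_{i+1} exp(−(x_{i+1} − x_i)/h))`. -/
theorem laplace_kernel_quadratic_form (n : ℕ) (h : ℝ) (hh : 0 < h)
    (x : Fin (n + 1) → ℝ) (hx : StrictMono x)
    (y : Fin (n + 1) → ℝ) (hy : ∀ i, y i = 1 ∨ y i = -1)
    (K : Matrix (Fin (n + 1)) (Fin (n + 1)) ℝ)
    (hK : ∀ i j, K i j = Real.exp (-|x i - x j| / h)) :
    IsUnit K.det ∧
    y ⬝ᵥ K⁻¹.mulVec y =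
      -(((n : ℝ) + 1) - 2) + 2 * ∑ i : Fin n,
        1 / (1 + y i.castSucc * y i.succ * Real.exp (-(x i.succ - x i.castSucc) / h)) := by
  have hKeq : ∀ a i, K.mulVec a i = ∑ j, Real.exp (-|x i - x j| / h) * a j := fun a i => by
    simp [Matrix.mulVec, dotProduct, hK]
  have hdet : IsUnit K.det := by
    rw [← Matrix.isUnit_iff_isUnit_det, ← Matrix.mulVec_surjective_iff_isUnit]
    intro z
    obtain ⟨a, ha, -⟩ := exists_laplace_kernel_solution hh n x hx z
    exact ⟨a, funext fun i => by rw [hKeq, ha]⟩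
  refine ⟨hdet, ?_⟩
  obtain ⟨a, ha, hq⟩ := exists_laplace_kernel_solution hh n x hx y
  have hKa : K.mulVec a = y := funext fun i => by rw [hKeq, ha]
  have hinv : K⁻¹.mulVec y = a := by
    rw [← hKa, Matrix.mulVec_mulVec, Matrix.nonsing_inv_mul _ hdet, Matrix.one_mulVec]
  have hterm : ∀ i : Fin n,
      (y i.castSucc - Real.exp (-(x i.succ - x i.castSucc) / h) * y i.succ) ^ 2 /
          (1 - Real.exp (-(x i.succ - x i.castSucc) / h) ^ 2) =
        2 * (1 / (1 + y i.castSucc * y i.succ *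
          Real.exp (-(x i.succ - x i.castSucc) / h))) - 1 := by
    intro i
    have hlt : x i.castSucc < x i.succ := hx Fin.castSucc_lt_succ
    have hr1 : Real.exp (-(x i.succ - x i.castSucc) / h) < 1 := by
      rw [Real.exp_lt_one_iff]
      exact div_neg_of_neg_of_pos (by linarith) hh
    have hr0 := Real.exp_pos (-(x i.succ - x i.castSucc) / h)
    generalize Real.exp (-(x i.succ - x i.castSucc) / h) = r at hr0 hr1 ⊢
    have hp : 1 + r ≠ 0 := by linarith
    have hm : 1 - r ≠ 0 := by linarith
    rw [show 1 - r ^ 2 = (1 + r) * (1 - r) by ring]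
    rcases hy i.castSucc with h1 | h1 <;> rcases hy i.succ with h2 | h2 <;> rw [h1, h2]
    · rw [show 1 + 1 * 1 * r = 1 + r by ring]
      field_simp
      ring
    · rw [show 1 + 1 * -1 * r = 1 - r by ring]
      field_simp
      ring
    · rw [show 1 + -1 * 1 * r = 1 - r by ring]
      field_simp
      ring
    · rw [show 1 + -1 * -1 * r = 1 + r by ring]
      field_simp
      ring
  have hlast : y (Fin.last n) ^ 2 = 1 := by
    rcases hy (Fin.last n) with h1 | h1 <;> simp [h1]
  rw [hinv, dotProduct, hq, hlast, Finset.sum_congr rfl fun i _ => hterm i,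
    Finset.sum_sub_distrib, ← Finset.mul_sum]
  simp
  ring
end

section
/- Fix h > 0 and two points x₁ < x₃ in ℝ with opposite labels y₁, y₃ ∈ {−1,+1}, y₁ ≠ y₃. For x₁ < u < x₃ define score_H(u) := min over ε ∈ {−1,+1} of ỹ_εᵀ K̃_u⁻¹ ỹ_ε, where K̃_u is the 3×3 Laplace kernel matrix of the points x₁, u, x₃ and ỹ_ε = (y₁, ε, y₃). Then for every u ∈ (x₁,x₃), score_H(u) ≤ 4/(1 − exp(−(x₃ − x₁)/h)) − 1, with equality when u = (x₁ + x₃)/2. -/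
open Matrix

/-- The Laplace-kernel matrix of a tuple of points in ℝ. -/
noncomputable def kerMat {n : ℕ} (h : ℝ) (pts : Fin n → ℝ) : Matrix (Fin n) (Fin n) ℝ :=
  Matrix.of fun i j => Real.exp (-|pts i - pts j| / h)

/-- The squared RKHS norm `yᵀ K⁻¹ y` of the minimum-norm Laplace-kernel interpolant. -/
noncomputable def qf {n : ℕ} (h : ℝ) (pts y : Fin n → ℝ) : ℝ :=
  y ⬝ᵥ (kerMat h pts)⁻¹.mulVec y

/-- The tridiagonal inverse of the Laplace-kernel matrix of three consecutive points, where `a` and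
`b` are the kernel values of the two neighbouring pairs. -/
theorem inv_markov_three {a b : ℝ} (ha : 1 - a ^ 2 ≠ 0) (hb : 1 - b ^ 2 ≠ 0) :
    (!![1, a, a * b; a, 1, b; a * b, b, 1] : Matrix (Fin 3) (Fin 3) ℝ)⁻¹ =
      !![1 / (1 - a ^ 2), -a / (1 - a ^ 2), 0;
        -a / (1 - a ^ 2), 1 / (1 - a ^ 2) + 1 / (1 - b ^ 2) - 1, -b / (1 - b ^ 2);
        0, -b / (1 - b ^ 2), 1 / (1 - b ^ 2)] := by
  apply Matrix.inv_eq_right_inv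
  ext i j
  fin_cases i <;> fin_cases j <;>
    simp [Matrix.mul_apply, Fin.sum_univ_three] <;> field_simp <;> ring

theorem kerMat_three {h x u z : ℝ} (hxu : x < u) (huz : u < z) :
    kerMat h ![x, u, z] =
      !![1, Real.exp (-(u - x) / h), Real.exp (-(u - x) / h) * Real.exp (-(z - u) / h);
        Real.exp (-(u - x) / h), 1, Real.exp (-(z - u) / h);
        Real.exp (-(u - x) / h) * Real.exp (-(z - u) / h), Real.exp (-(z - u) / h), 1] := by
  have h₁ : |x - u| = u - x := by rw [abs_sub_comm, abs_of_pos (sub_pos.2 hxu)]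
  have h₂ : |u - z| = z - u := by rw [abs_sub_comm, abs_of_pos (sub_pos.2 huz)]
  have h₃ : |x - z| = z - x := by rw [abs_sub_comm, abs_of_pos (sub_pos.2 (hxu.trans huz))]
  have hmul : Real.exp (-(u - x) / h) * Real.exp (-(z - u) / h) = Real.exp (-(z - x) / h) := by
    rw [← Real.exp_add]
    ring_nf
  rw [hmul]
  ext i j
  fin_cases i <;> fin_cases j <;>
    simp [kerMat, h₁, h₂, h₃, abs_sub_comm u x, abs_sub_comm z u, abs_sub_comm z x]

theorem exp_neg_div_lt_one {h t : ℝ} (hh : 0 < h) (ht : 0 < t) : Real.exp (-t / h) < 1 :=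
  Real.exp_lt_one_iff.2 (div_neg_of_neg_of_pos (neg_neg_of_pos ht) hh)

theorem qf_three {h x u z : ℝ} (hh : 0 < h) (hxu : x < u) (huz : u < z) (p q r : ℝ) :
    qf h ![x, u, z] ![p, q, r] =
      p ^ 2 + (q - Real.exp (-(u - x) / h) * p) ^ 2 / (1 - Real.exp (-(u - x) / h) ^ 2) +
        (r - Real.exp (-(z - u) / h) * q) ^ 2 / (1 - Real.exp (-(z - u) / h) ^ 2) := by
  have one_sub_sq_ne {t : ℝ} (ht : 0 < t) : 1 - Real.exp (-t / h) ^ 2 ≠ 0 := by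
    have hlt : Real.exp (-t / h) < 1 := exp_neg_div_lt_one hh ht
    nlinarith [Real.exp_pos (-t / h)]
  have ha := one_sub_sq_ne (sub_pos.2 hxu)
  have hb := one_sub_sq_ne (sub_pos.2 huz)
  rw [qf, kerMat_three hxu huz, inv_markov_three ha hb]
  generalize Real.exp (-(u - x) / h) = a at *
  generalize Real.exp (-(z - u) / h) = b at *
  simp [dotProduct, Matrix.mulVec, Fin.sum_univ_three]
  field_simp
  ring

/-- The squared norm when the middle label agrees with one neighbour, with kernel value `a`, and
disagrees with the other, with kernel value `b`. -/
theorem one_add_div_add_div {a b : ℝ} (ha : 0 < a) (ha' : a < 1) (hb : 0 < b) (hb' : b < 1) :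
    1 + (1 - a) ^ 2 / (1 - a ^ 2) + (1 + b) ^ 2 / (1 - b ^ 2) =
      2 / (1 + a) + 2 / (1 - b) - 1 := by
  have h₁ : 1 - a ^ 2 ≠ 0 := by nlinarith
  have h₂ : 1 - b ^ 2 ≠ 0 := by nlinarith
  have h₃ : 1 + a ≠ 0 := by linarith
  have h₄ : 1 - b ≠ 0 := by linarith
  field_simp
  ring

theorem two_div_add_two_div_le {a b : ℝ} (ha' : a < 1) (hb : 0 < b) (hba : b ≤ a) :
    2 / (1 + a) + 2 / (1 - b) ≤ 4 / (1 - a * b) := by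
  have ha : 0 < a := hb.trans_le hba
  have h₁ : 0 < 1 + a := by linarith
  have h₂ : 0 < 1 - b := by linarith
  have h₃ : 0 < 1 - a * b := by nlinarith
  rw [div_add_div _ _ h₁.ne' h₂.ne', div_le_div_iff₀ (mul_pos h₁ h₂) h₃]
  nlinarith [mul_nonneg (sub_nonneg.2 hba) (mul_pos ha hb).le]

theorem min_qf_opposite_labels {h x u z y₁ y₃ : ℝ} (hh : 0 < h) (hxu : x < u) (huz : u < z)
    (hy₁ : y₁ = 1 ∨ y₁ = -1) (hy₃ : y₃ = 1 ∨ y₃ = -1) (hne : y₁ ≠ y₃) :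
    min (qf h ![x, u, z] ![y₁, 1, y₃]) (qf h ![x, u, z] ![y₁, -1, y₃]) =
      min (2 / (1 + Real.exp (-(u - x) / h)) + 2 / (1 - Real.exp (-(z - u) / h)) - 1)
        (2 / (1 + Real.exp (-(z - u) / h)) + 2 / (1 - Real.exp (-(u - x) / h)) - 1) := by
  have ha' := exp_neg_div_lt_one hh (sub_pos.2 hxu)
  have hb' := exp_neg_div_lt_one hh (sub_pos.2 huz)
  have ha := Real.exp_pos (-(u - x) / h)
  have hb := Real.exp_pos (-(z - u) / h)
  rw [qf_three hh hxu huz, qf_three hh hxu huz, ← one_add_div_add_div ha ha' hb hb',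
    ← one_add_div_add_div hb hb' ha ha']
  rcases hy₁ with rfl | rfl <;> rcases hy₃ with rfl | rfl
  · exact absurd rfl hne
  · congr 1 <;> ring
  · rw [min_comm]
    congr 1 <;> ring
  · exact absurd rfl hne

/-- For two oppositely labeled points `x₁ < x₃`, the score
`score_H(u) = min_{ε = ±1} ỹ_εᵀ K̃_u⁻¹ ỹ_ε` satisfies
`score_H(u) ≤ 4/(1 − exp(−(x₃ − x₁)/h)) − 1` on `(x₁, x₃)`, with equality at the midpoint. -/
theorem laplace_score_opposite_labels_midpoint (h x₁ x₃ y₁ y₃ : ℝ)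
    (hh : 0 < h) (hx : x₁ < x₃)
    (hy₁ : y₁ = 1 ∨ y₁ = -1) (hy₃ : y₃ = 1 ∨ y₃ = -1) (hne : y₁ ≠ y₃) :
    (∀ u : ℝ, x₁ < u → u < x₃ →
      min (qf h ![x₁, u, x₃] ![y₁, 1, y₃]) (qf h ![x₁, u, x₃] ![y₁, -1, y₃])
        ≤ 4 / (1 - Real.exp (-(x₃ - x₁) / h)) - 1) ∧
    min (qf h ![x₁, (x₁ + x₃) / 2, x₃] ![y₁, 1, y₃])
        (qf h ![x₁, (x₁ + x₃) / 2, x₃] ![y₁, -1, y₃])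
      = 4 / (1 - Real.exp (-(x₃ - x₁) / h)) - 1 := by
  have exp_mul (u : ℝ) : Real.exp (-(u - x₁) / h) * Real.exp (-(x₃ - u) / h) =
      Real.exp (-(x₃ - x₁) / h) := by
    rw [← Real.exp_add]
    ring_nf
  constructor
  · intro u hu₁ hu₃
    rw [min_qf_opposite_labels hh hu₁ hu₃ hy₁ hy₃ hne, ← exp_mul u]
    have ha := exp_neg_div_lt_one hh (sub_pos.2 hu₁)
    have hb := exp_neg_div_lt_one hh (sub_pos.2 hu₃)
    rcases le_total (Real.exp (-(x₃ - u) / h)) (Real.exp (-(u - x₁) / h)) with hle | hle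
    · exact (min_le_left _ _).trans
        (sub_le_sub_right (two_div_add_two_div_le ha (Real.exp_pos _) hle) 1)
    · rw [mul_comm (Real.exp (-(u - x₁) / h))]
      exact (min_le_right _ _).trans
        (sub_le_sub_right (two_div_add_two_div_le hb (Real.exp_pos _) hle) 1)
  · have hm₁ : x₁ < (x₁ + x₃) / 2 := by linarith
    have hm₃ : (x₁ + x₃) / 2 < x₃ := by linarith
    have hmid : x₃ - (x₁ + x₃) / 2 = (x₁ + x₃) / 2 - x₁ := by ring
    rw [min_qf_opposite_labels hh hm₁ hm₃ hy₁ hy₃ hne, ← exp_mul ((x₁ + x₃) / 2), hmid, min_self]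
    have hlt : Real.exp (-((x₁ + x₃) / 2 - x₁) / h) < 1 :=
      exp_neg_div_lt_one hh (sub_pos.2 hm₁)
    have hpos := Real.exp_pos (-((x₁ + x₃) / 2 - x₁) / h)
    generalize Real.exp (-((x₁ + x₃) / 2 - x₁) / h) = a at *
    have h₁ : 1 + a ≠ 0 := by linarith
    have h₂ : 1 - a ≠ 0 := by linarith
    have h₃ : 1 - a ^ 2 ≠ 0 := by nlinarith
    rw [← pow_two]
    field_simp
    ring
end

section
/- Fix h > 0 and two points x₁ < x₃ in ℝ with equal labels y₁ = y₃ ∈ {−1,+1}. For x₁ < u < x₃ define score_H(u) := min over ε ∈ {−1,+1} of ỹ_εᵀ K̃_u⁻¹ ỹ_ε, where K̃_u is the 3×3 Laplace kernel matrix of the points x₁, u, x₃ and ỹ_ε = (y₁, ε, y₃). Then for every u ∈ (x₁,x₃), score_H(u) ≤ 4/(1 + exp(−(x₃ − x₁)/(2h))) − 1, with equality when u = (x₁ + x₃)/2. -/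
open Matrix

/-- The Laplace-kernel matrix of three increasing points is inverted by a tridiagonal matrix, which
splits the squared norm of the interpolant into Markov increments. -/
theorem qf_three_of_lt {h x₁ u x₃ : ℝ} (hh : 0 < h) (h₁ : x₁ < u) (h₃ : u < x₃) (p q r : ℝ) :
    qf h ![x₁, u, x₃] ![p, q, r] =
      q ^ 2 + (p - Real.exp (-(u - x₁) / h) * q) ^ 2 / (1 - Real.exp (-(u - x₁) / h) ^ 2)
        + (r - Real.exp (-(x₃ - u) / h) * q) ^ 2 / (1 - Real.exp (-(x₃ - u) / h) ^ 2) := by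
  have ha1 : Real.exp (-(u - x₁) / h) < 1 :=
    Real.exp_lt_one_iff.2 (div_neg_of_neg_of_pos (by linarith) hh)
  have hb1 : Real.exp (-(x₃ - u) / h) < 1 :=
    Real.exp_lt_one_iff.2 (div_neg_of_neg_of_pos (by linarith) hh)
  have hab : Real.exp (-(x₃ - x₁) / h) = Real.exp (-(u - x₁) / h) * Real.exp (-(x₃ - u) / h) := by
    rw [← Real.exp_add]
    ring_nf
  have ha0 := Real.exp_pos (-(u - x₁) / h)
  have hb0 := Real.exp_pos (-(x₃ - u) / h)
  have hker : kerMat h ![x₁, u, x₃] =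
      !![1, Real.exp (-(u - x₁) / h), Real.exp (-(x₃ - x₁) / h);
        Real.exp (-(u - x₁) / h), 1, Real.exp (-(x₃ - u) / h);
        Real.exp (-(x₃ - x₁) / h), Real.exp (-(x₃ - u) / h), 1] := by
    have e₁ : |x₁ - u| = u - x₁ := by rw [abs_of_neg (by linarith)]; ring
    have e₂ : |x₁ - x₃| = x₃ - x₁ := by rw [abs_of_neg (by linarith)]; ring
    have e₃ : |u - x₃| = x₃ - u := by rw [abs_of_neg (by linarith)]; ring
    have f₁ : |u - x₁| = u - x₁ := abs_of_pos (by linarith)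
    have f₂ : |x₃ - x₁| = x₃ - x₁ := abs_of_pos (by linarith)
    have f₃ : |x₃ - u| = x₃ - u := abs_of_pos (by linarith)
    ext i j
    fin_cases i <;> fin_cases j <;> simp [kerMat, e₁, e₂, e₃, f₁, f₂, f₃]
  rw [hab] at hker
  generalize Real.exp (-(u - x₁) / h) = a at *
  generalize Real.exp (-(x₃ - u) / h) = b at *
  have ha : 1 - a ^ 2 ≠ 0 := by nlinarith
  have hb : 1 - b ^ 2 ≠ 0 := by nlinarith
  have hinv : (kerMat h ![x₁, u, x₃])⁻¹ =
      !![1 / (1 - a ^ 2), -a / (1 - a ^ 2), 0;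
        -a / (1 - a ^ 2), 1 / (1 - a ^ 2) + 1 / (1 - b ^ 2) - 1, -b / (1 - b ^ 2);
        0, -b / (1 - b ^ 2), 1 / (1 - b ^ 2)] := by
    rw [hker]
    apply Matrix.inv_eq_right_inv
    ext i j
    fin_cases i <;> fin_cases j <;> simp [Matrix.mul_apply, Fin.sum_univ_three] <;>
      field_simp <;> ring
  rw [qf, hinv]
  simp [Matrix.mulVec, dotProduct, Fin.sum_univ_three]
  field_simp
  ring

/-- Labelling the middle point like its two neighbours attains the minimum over both labels. -/
theorem min_qf_three_of_equal_labels {h x₁ u x₃ y : ℝ} (hh : 0 < h) (h₁ : x₁ < u) (h₃ : u < x₃)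
    (hy : y = 1 ∨ y = -1) :
    min (qf h ![x₁, u, x₃] ![y, 1, y]) (qf h ![x₁, u, x₃] ![y, -1, y]) =
      2 / (1 + Real.exp (-(u - x₁) / h)) + 2 / (1 + Real.exp (-(x₃ - u) / h)) - 1 := by
  have ha1 : Real.exp (-(u - x₁) / h) < 1 :=
    Real.exp_lt_one_iff.2 (div_neg_of_neg_of_pos (by linarith) hh)
  have hb1 : Real.exp (-(x₃ - u) / h) < 1 :=
    Real.exp_lt_one_iff.2 (div_neg_of_neg_of_pos (by linarith) hh)
  have ha0 := Real.exp_pos (-(u - x₁) / h)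
  have hb0 := Real.exp_pos (-(x₃ - u) / h)
  rw [qf_three_of_lt hh h₁ h₃, qf_three_of_lt hh h₁ h₃]
  generalize Real.exp (-(u - x₁) / h) = a at *
  generalize Real.exp (-(x₃ - u) / h) = b at *
  have same : ∀ t : ℝ, 0 < t → t < 1 → (1 - t) ^ 2 / (1 - t ^ 2) = 2 / (1 + t) - 1 := by
    intro t h0 h1
    have : 1 - t ^ 2 ≠ 0 := by nlinarith
    have : 1 + t ≠ 0 := by linarith
    field_simp
    ring
  have mono : ∀ t : ℝ, 0 < t → t < 1 → (1 - t) ^ 2 / (1 - t ^ 2) ≤ (1 + t) ^ 2 / (1 - t ^ 2) := by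
    intro t h0 h1
    have : 0 < 1 - t ^ 2 := by nlinarith
    gcongr
    linarith
  have sa := same a ha0 ha1
  have sb := same b hb0 hb1
  have ma := mono a ha0 ha1
  have mb := mono b hb0 hb1
  rcases hy with rfl | rfl
  · rw [min_eq_left] <;> ring_nf at * <;> linarith
  · rw [min_eq_right] <;> ring_nf at * <;> linarith

/-- If `a * b = c ^ 2` with `c < 1`, then `1 / (1 + a) + 1 / (1 + b)` is largest at `a = b = c`. -/
theorem two_div_one_add_add_le {a b c : ℝ} (ha : 0 < a) (hb : 0 < b) (hc : 0 < c) (hc1 : c < 1)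
    (habc : a * b = c ^ 2) : 2 / (1 + a) + 2 / (1 + b) ≤ 4 / (1 + c) := by
  have hs : 2 * c ≤ a + b := by nlinarith [sq_nonneg (a - b)]
  rw [div_add_div _ _ (by positivity) (by positivity), div_le_div_iff₀ (by positivity) (by positivity)]
  have key : 4 * ((1 + a) * (1 + b)) - (2 * (1 + b) + (1 + a) * 2) * (1 + c)
      = 2 * (1 - c) * (a + b - 2 * c) + 4 * (a * b - c ^ 2) := by ring
  have := mul_nonneg (sub_nonneg.2 hc1.le) (sub_nonneg.2 hs)
  nlinarith

/-- For two identically labeled points `x₁ < x₃`, the score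
`score_H(u) = min_{ε = ±1} ỹ_εᵀ K̃_u⁻¹ ỹ_ε` satisfies
`score_H(u) ≤ 4/(1 + exp(−(x₃ − x₁)/(2h))) − 1` on `(x₁, x₃)`, with equality at the
midpoint. -/
theorem laplace_score_equal_labels_midpoint (h x₁ x₃ y₁ y₃ : ℝ)
    (hh : 0 < h) (hx : x₁ < x₃)
    (hy₁ : y₁ = 1 ∨ y₁ = -1) (hy₃ : y₃ = 1 ∨ y₃ = -1) (heq : y₁ = y₃) :
    (∀ u : ℝ, x₁ < u → u < x₃ →
      min (qf h ![x₁, u, x₃] ![y₁, 1, y₃]) (qf h ![x₁, u, x₃] ![y₁, -1, y₃])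
        ≤ 4 / (1 + Real.exp (-(x₃ - x₁) / (2 * h))) - 1) ∧
    min (qf h ![x₁, (x₁ + x₃) / 2, x₃] ![y₁, 1, y₃])
        (qf h ![x₁, (x₁ + x₃) / 2, x₃] ![y₁, -1, y₃])
      = 4 / (1 + Real.exp (-(x₃ - x₁) / (2 * h))) - 1 := by
  subst heq
  constructor
  · intro u h₁ h₃
    rw [min_qf_three_of_equal_labels hh h₁ h₃ hy₁]
    refine sub_le_sub_right (two_div_one_add_add_le (Real.exp_pos _) (Real.exp_pos _)
      (Real.exp_pos _) (Real.exp_lt_one_iff.2 (div_neg_of_neg_of_pos (by linarith) (by linarith))) ?_) 1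
    rw [← Real.exp_add, ← Real.exp_nat_mul]
    congr 1
    push_cast
    field_simp
    ring
  · rw [min_qf_three_of_equal_labels hh (by linarith) (by linarith) hy₁]
    have e₁ : -((x₁ + x₃) / 2 - x₁) / h = -(x₃ - x₁) / (2 * h) := by
      field_simp
      ring
    have e₃ : -(x₃ - (x₁ + x₃) / 2) / h = -(x₃ - x₁) / (2 * h) := by
      field_simp
      ring
    rw [e₁, e₃]
    ring
end

section
/- Fix h > 0, points x₁ < … < x_n in ℝ, and labels y ∈ {−1,+1}ⁿ. Suppose y_j ≠ y_{j+1} for some index j (an oppositely labeled consecutive pair) and y_k = y_{k+1} for some index k (an identically labeled consecutive pair). Let m_j = (x_j + x_{j+1})/2. Then for every u with x_k < u < x_{k+1}, score_H(m_j) ≥ score_H(u), where for x_i < u < x_{i+1} the score is score_H(u) := min over ε ∈ {−1,+1} of ỹ_εᵀ K̃_u⁻¹ ỹ_ε, with K̃_u the (n+1)×(n+1) Laplace kernel matrix of the points {x₁,…,x_n, u} and ỹ_ε the vector of labels extending y by assigning ε to u (coordinates ordered to match the points). -/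
open Matrix

/-- The maximin score of an unlabeled point `u` given labeled points `(x, y)`:
the minimum over the two candidate labels `ε = ±1` of the squared RKHS norm of the
minimum-norm Laplace-kernel interpolant of the augmented labeled set. -/
noncomputable def scoreH {n : ℕ} (h : ℝ) (x y : Fin n → ℝ) (u : ℝ) : ℝ :=
  min (qf h (Fin.snoc x u) (Fin.snoc y 1)) (qf h (Fin.snoc x u) (Fin.snoc y (-1)))

/-- The vector of Laplace kernel values between the points and `u`. -/
noncomputable def kerVec {n : ℕ} (h : ℝ) (pts : Fin n → ℝ) (u : ℝ) : Fin n → ℝ :=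
  fun i => Real.exp (-|pts i - u| / h)

lemma kerMat_transpose {n : ℕ} (h : ℝ) (x : Fin n → ℝ) : (kerMat h x)ᵀ = kerMat h x := by
  ext i j
  simp [kerMat, abs_sub_comm]

lemma kerMat_snoc_mulVec {n : ℕ} (h : ℝ) (x v : Fin n → ℝ) (u c : ℝ) :
    kerMat h (Fin.snoc x u : Fin (n + 1) → ℝ) *ᵥ (Fin.snoc v c : Fin (n + 1) → ℝ) =
      (Fin.snoc (kerMat h x *ᵥ v + c • kerVec h x u) (kerVec h x u ⬝ᵥ v + c) :
        Fin (n + 1) → ℝ) := by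
  ext i
  refine Fin.lastCases ?_ (fun i => ?_) i
  · simp [mulVec, dotProduct, Fin.sum_univ_castSucc, kerMat, kerVec, abs_sub_comm]
  · simp [mulVec, dotProduct, Fin.sum_univ_castSucc, kerMat, kerVec, mul_comm]

lemma snoc_dotProduct_snoc {n : ℕ} (v w : Fin n → ℝ) (a b : ℝ) :
    (Fin.snoc v a : Fin (n + 1) → ℝ) ⬝ᵥ (Fin.snoc w b : Fin (n + 1) → ℝ) = v ⬝ᵥ w + a * b := by
  simp [dotProduct, Fin.sum_univ_castSucc]

lemma isUnit_kerMat_snoc {n : ℕ} {h : ℝ} {x w : Fin n → ℝ} {u : ℝ} (hK : IsUnit (kerMat h x))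
    (hw : kerMat h x *ᵥ w = kerVec h x u) (hs : 1 - kerVec h x u ⬝ᵥ w ≠ 0) :
    IsUnit (kerMat h (Fin.snoc x u : Fin (n + 1) → ℝ)) := by
  rw [← mulVec_injective_iff_isUnit, ← coe_mulVecLin, injective_iff_map_eq_zero]
  intro z hz
  obtain ⟨v, c, rfl⟩ : ∃ v : Fin n → ℝ, ∃ c : ℝ, z = (Fin.snoc v c : Fin (n + 1) → ℝ) :=
    ⟨Fin.init z, z (Fin.last n), (Fin.snoc_init_self z).symm⟩
  rw [mulVecLin_apply, kerMat_snoc_mulVec] at hz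
  have h1 : kerMat h x *ᵥ v + c • kerVec h x u = 0 := by
    ext i
    simpa using congrFun hz i.castSucc
  have h2 : kerVec h x u ⬝ᵥ v + c = 0 := by
    simpa using congrFun hz (Fin.last n)
  have hv : v = -(c • w) := by
    apply mulVec_injective_iff_isUnit.2 hK
    simp only [mulVec_neg, mulVec_smul, hw]
    exact eq_neg_of_add_eq_zero_left h1
  have hc : c = 0 := by
    rw [hv, dotProduct_neg, dotProduct_smul, smul_eq_mul] at h2
    have hcs : c * (1 - kerVec h x u ⬝ᵥ w) = 0 := by linear_combination h2
    exact (mul_eq_zero.1 hcs).resolve_right hs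
  subst hc
  ext i
  refine Fin.lastCases ?_ (fun i => ?_) i <;> simp [hv]

/-- Adding a point `u` with label `ε` increases the squared norm by the squared prediction error
divided by the conditional variance at `u`. -/
lemma qf_snoc {n : ℕ} {h : ℝ} {x w : Fin n → ℝ} {u : ℝ} (hK : IsUnit (kerMat h x))
    (hw : kerMat h x *ᵥ w = kerVec h x u) (hs : 1 - kerVec h x u ⬝ᵥ w ≠ 0)
    (y : Fin n → ℝ) (ε : ℝ) :
    qf h (Fin.snoc x u : Fin (n + 1) → ℝ) (Fin.snoc y ε) =
      qf h x y + (ε - w ⬝ᵥ y) ^ 2 / (1 - kerVec h x u ⬝ᵥ w) := by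
  have hdet := (isUnit_iff_isUnit_det _).1 hK
  have hdet' := (isUnit_iff_isUnit_det _).1 (isUnit_kerMat_snoc hK hw hs)
  set s := 1 - kerVec h x u ⬝ᵥ w with hs_def
  set c := (ε - w ⬝ᵥ y) / s with hc
  set z := (kerMat h x)⁻¹ *ᵥ y with hz
  have hKz : kerMat h x *ᵥ z = y := by
    rw [hz, mulVec_mulVec, mul_nonsing_inv _ hdet, one_mulVec]
  have hkz : kerVec h x u ⬝ᵥ z = w ⬝ᵥ y := by
    rw [← hw, ← vecMul_transpose, kerMat_transpose, ← dotProduct_mulVec, hKz]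
  have hsol : kerMat h (Fin.snoc x u : Fin (n + 1) → ℝ) *ᵥ
      (Fin.snoc (z - c • w) c : Fin (n + 1) → ℝ) = (Fin.snoc y ε : Fin (n + 1) → ℝ) := by
    rw [kerMat_snoc_mulVec, mulVec_sub, mulVec_smul, hKz, hw, dotProduct_sub, dotProduct_smul,
      hkz, sub_add_cancel]
    congr 1
    have hcs : c * s = ε - w ⬝ᵥ y := div_mul_cancel₀ _ hs
    rw [smul_eq_mul]
    linear_combination hcs + c * hs_def
  have hinv : (kerMat h (Fin.snoc x u : Fin (n + 1) → ℝ))⁻¹ *ᵥ (Fin.snoc y ε : Fin (n + 1) → ℝ) =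
      (Fin.snoc (z - c • w) c : Fin (n + 1) → ℝ) := by
    rw [← hsol, mulVec_mulVec, nonsing_inv_mul _ hdet', one_mulVec]
  rw [qf, hinv, snoc_dotProduct_snoc, dotProduct_sub, dotProduct_smul, dotProduct_comm y w, qf,
    smul_eq_mul, hc]
  ring

lemma exp_neg_abs_mul {h a b c : ℝ} (hab : a ≤ b) (hbc : b ≤ c) :
    Real.exp (-|a - c| / h) = Real.exp (-|a - b| / h) * Real.exp (-|b - c| / h) := by
  rw [abs_of_nonpos (by linarith), abs_of_nonpos (by linarith), abs_of_nonpos (by linarith),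
    ← Real.exp_add]
  congr 1
  ring

lemma exp_neg_abs_lt_one {h a b : ℝ} (hh : 0 < h) (hab : a ≠ b) :
    Real.exp (-|a - b| / h) < 1 := by
  rw [Real.exp_lt_one_iff]
  exact div_neg_of_neg_of_pos (neg_neg_of_pos (abs_pos.2 (sub_ne_zero.2 hab))) hh

lemma isUnit_kerMat {h : ℝ} (hh : 0 < h) {n : ℕ} (x : Fin n → ℝ) (hx : StrictMono x) :
    IsUnit (kerMat h x) := by
  induction n with
  | zero => exact (isUnit_iff_isUnit_det _).2 (by simp)
  | succ n ih =>
    have hinit : StrictMono (Fin.init x) := fun a b hab => hx (Fin.castSucc_lt_castSucc_iff.2 hab)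
    have hK := ih _ hinit
    rw [← Fin.snoc_init_self x]
    cases n with
    | zero => exact isUnit_kerMat_snoc (w := 0) hK (by ext i; exact i.elim0) (by simp)
    | succ m =>
      have hlt : Fin.init x (Fin.last m) < x (Fin.last (m + 1)) := hx (Fin.castSucc_lt_last _)
      set A := Real.exp (-|Fin.init x (Fin.last m) - x (Fin.last (m + 1))| / h) with hA
      refine isUnit_kerMat_snoc (w := Pi.single (Fin.last m) A) hK ?_ ?_
      · ext l
        simp only [mulVec_single, kerMat, kerVec, col_apply, of_apply, Pi.smul_apply,
          MulOpposite.smul_eq_mul_unop, MulOpposite.unop_op]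
        exact (exp_neg_abs_mul (hinit.monotone (Fin.le_last l)) hlt.le).symm
      · have h0 : 0 < A := Real.exp_pos _
        have h1 : A < 1 := exp_neg_abs_lt_one hh hlt.ne
        simp only [dotProduct_single, kerVec, ← hA]
        nlinarith

/-- In a gap between consecutive points, the score increment depends only on the two endpoints:
`A` and `B` are the kernel values of the query point with the left and right endpoints. -/
lemma qf_snoc_of_mem_gap {h : ℝ} (hh : 0 < h) {n : ℕ} {x : Fin n → ℝ} (hx : StrictMono x)
    (y : Fin n → ℝ) {i i' : Fin n} (hi : (i' : ℕ) = i + 1) {u : ℝ} (h1 : x i < u) (h2 : u < x i')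
    {A B : ℝ} (hA : A = Real.exp (-|x i - u| / h)) (hB : B = Real.exp (-|u - x i'| / h)) (ε : ℝ) :
    qf h (Fin.snoc x u : Fin (n + 1) → ℝ) (Fin.snoc y ε) = qf h x y +
      (ε - (A * (1 - B ^ 2) / (1 - A ^ 2 * B ^ 2) * y i +
        B * (1 - A ^ 2) / (1 - A ^ 2 * B ^ 2) * y i')) ^ 2 /
        ((1 - A ^ 2) * (1 - B ^ 2) / (1 - A ^ 2 * B ^ 2)) := by
  have hA0 : 0 < A := hA ▸ Real.exp_pos _
  have hB0 : 0 < B := hB ▸ Real.exp_pos _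
  have hA1 : A < 1 := hA ▸ exp_neg_abs_lt_one hh h1.ne
  have hB1 : B < 1 := hB ▸ exp_neg_abs_lt_one hh h2.ne
  have hA2 : 0 < 1 - A ^ 2 := by nlinarith
  have hB2 : 0 < 1 - B ^ 2 := by nlinarith
  have hD : 0 < 1 - A ^ 2 * B ^ 2 := by nlinarith [sq_nonneg B]
  set p := A * (1 - B ^ 2) / (1 - A ^ 2 * B ^ 2) with hp
  set q := B * (1 - A ^ 2) / (1 - A ^ 2 * B ^ 2) with hq
  have hpq : p + A * B * q = A := by rw [hp, hq]; field_simp; ring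
  have hqp : A * B * p + q = B := by rw [hp, hq]; field_simp; ring
  have hs : 1 - kerVec h x u ⬝ᵥ (Pi.single i p + Pi.single i' q) =
      (1 - A ^ 2) * (1 - B ^ 2) / (1 - A ^ 2 * B ^ 2) := by
    rw [dotProduct_add, dotProduct_single, dotProduct_single]
    simp only [kerVec]
    rw [abs_sub_comm (x i') u, ← hA, ← hB, hp, hq]
    field_simp
    ring
  have hw : kerMat h x *ᵥ (Pi.single i p + Pi.single i' q) = kerVec h x u := by
    ext l
    simp only [mulVec_add, mulVec_single, kerMat, kerVec, col_apply, of_apply, Pi.smul_apply,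
      Pi.add_apply, MulOpposite.smul_eq_mul_unop, MulOpposite.unop_op]
    rcases le_or_gt l i with hl | hl
    · have hxl := hx.monotone hl
      rw [exp_neg_abs_mul (hxl.trans h1.le) h2.le, exp_neg_abs_mul hxl h1.le, ← hA, ← hB]
      linear_combination Real.exp (-|x l - x i| / h) * hpq
    · have hxl : x i' ≤ x l := hx.monotone (Fin.le_def.2 (by have := Fin.lt_def.1 hl; omega))
      rw [abs_sub_comm (x l) (x i), abs_sub_comm (x l) (x i'), abs_sub_comm (x l) u,
        exp_neg_abs_mul h1.le (h2.le.trans hxl), exp_neg_abs_mul h2.le hxl, ← hA, ← hB]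
      linear_combination Real.exp (-|x i' - x l| / h) * hqp
  rw [qf_snoc (isUnit_kerMat hh x hx) hw (by rw [hs]; positivity), hs, add_dotProduct,
    single_dotProduct, single_dotProduct]

lemma same_gap_increment_le_one {A B ε : ℝ} (hA0 : 0 < A) (hA1 : A < 1) (hB0 : 0 < B)
    (hB1 : B < 1) (hε : ε ^ 2 = 1) :
    (ε - (A * (1 - B ^ 2) / (1 - A ^ 2 * B ^ 2) * ε +
        B * (1 - A ^ 2) / (1 - A ^ 2 * B ^ 2) * ε)) ^ 2 /
        ((1 - A ^ 2) * (1 - B ^ 2) / (1 - A ^ 2 * B ^ 2)) ≤ 1 := by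
  have hAB : A * B < 1 := by nlinarith
  have ha : 0 < 1 - A := by linarith
  have hb : 0 < 1 - B := by linarith
  have hc : 0 < 1 - A * B := by linarith
  have e1 : 1 - A ^ 2 = (1 - A) * (1 + A) := by ring
  have e2 : 1 - B ^ 2 = (1 - B) * (1 + B) := by ring
  have e3 : 1 - A ^ 2 * B ^ 2 = (1 - A * B) * (1 + A * B) := by ring
  have hpos : 0 < (1 + A) * (1 + B) * (1 + A * B) := by positivity
  have herr : ε - (A * (1 - B ^ 2) / (1 - A ^ 2 * B ^ 2) * ε +
      B * (1 - A ^ 2) / (1 - A ^ 2 * B ^ 2) * ε) = ε * ((1 - A) * (1 - B) / (1 + A * B)) := by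
    rw [e1, e2, e3]
    field_simp
    ring
  have key : (ε * ((1 - A) * (1 - B) / (1 + A * B))) ^ 2 /
      ((1 - A ^ 2) * (1 - B ^ 2) / (1 - A ^ 2 * B ^ 2)) =
      (1 - A) * (1 - B) * (1 - A * B) / ((1 + A) * (1 + B) * (1 + A * B)) := by
    rw [mul_pow, hε, e1, e2, e3]
    field_simp
  rw [herr, key, div_le_one hpos]
  gcongr <;> nlinarith [mul_pos hA0 hB0]

lemma one_le_opposite_midpoint_increment {A ε δ : ℝ} (hA0 : 0 < A) (hA1 : A < 1)
    (hε : ε ^ 2 = 1) :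
    1 ≤ (ε - (A * (1 - A ^ 2) / (1 - A ^ 2 * A ^ 2) * δ +
        A * (1 - A ^ 2) / (1 - A ^ 2 * A ^ 2) * -δ)) ^ 2 /
        ((1 - A ^ 2) * (1 - A ^ 2) / (1 - A ^ 2 * A ^ 2)) := by
  have hA2 : 0 < 1 - A ^ 2 := by nlinarith
  have hD : 0 < 1 - A ^ 2 * A ^ 2 := by nlinarith [sq_nonneg A]
  rw [mul_neg, add_neg_cancel, sub_zero, hε, one_div_div, one_le_div (by positivity)]
  nlinarith [mul_pos (pow_pos hA0 2) hA2]

/-- The midpoint of an oppositely labeled consecutive pair scores at least as high as any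
point lying between an identically labeled consecutive pair. -/
theorem laplace_score_opposite_midpoint_beats_same_gap (n : ℕ) (h : ℝ) (hh : 0 < h)
    (x y : Fin n → ℝ) (hx : StrictMono x) (hy : ∀ i, y i = 1 ∨ y i = -1)
    (j k : ℕ) (hj : j + 1 < n) (hk : k + 1 < n)
    (hjy : y ⟨j, by omega⟩ ≠ y ⟨j + 1, hj⟩)
    (hky : y ⟨k, by omega⟩ = y ⟨k + 1, hk⟩) :
    ∀ u : ℝ, x ⟨k, by omega⟩ < u → u < x ⟨k + 1, hk⟩ →
      scoreH h x y u ≤ scoreH h x y ((x ⟨j, by omega⟩ + x ⟨j + 1, hj⟩) / 2) := by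
  intro u hu1 hu2
  have hsq : ∀ i, y i ^ 2 = 1 := fun i => by rcases hy i with h1 | h1 <;> simp [h1]
  have hle : scoreH h x y u ≤ qf h x y + 1 := by
    have hq := qf_snoc_of_mem_gap hh hx y (i := ⟨k, by omega⟩) (i' := ⟨k + 1, hk⟩) rfl hu1 hu2
      rfl rfl (y ⟨k, by omega⟩)
    rw [← hky] at hq
    have hinc := same_gap_increment_le_one (Real.exp_pos _) (exp_neg_abs_lt_one hh hu1.ne)
      (Real.exp_pos _) (exp_neg_abs_lt_one hh hu2.ne) (hsq ⟨k, by omega⟩)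
    have hbound := hq.le.trans (add_le_add_right hinc _)
    rcases hy ⟨k, by omega⟩ with h1 | h1 <;> rw [h1] at hbound
    · exact (min_le_left _ _).trans hbound
    · exact (min_le_right _ _).trans hbound
  have hlt : x ⟨j, by omega⟩ < x ⟨j + 1, hj⟩ := hx (Fin.lt_def.2 (Nat.lt_succ_self j))
  set m := (x ⟨j, by omega⟩ + x ⟨j + 1, hj⟩) / 2 with hm
  have hm1 : x ⟨j, by omega⟩ < m := by linarith
  have hm2 : m < x ⟨j + 1, hj⟩ := by linarith
  have hopp : y ⟨j + 1, hj⟩ = -y ⟨j, by omega⟩ := by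
    rcases hy ⟨j, by omega⟩ with h1 | h1 <;> rcases hy ⟨j + 1, hj⟩ with h2 | h2 <;>
      simp_all
  have hdist : x ⟨j, by omega⟩ - m = m - x ⟨j + 1, hj⟩ := by linarith
  have hge : ∀ ε : ℝ, ε ^ 2 = 1 →
      qf h x y + 1 ≤ qf h (Fin.snoc x m : Fin (n + 1) → ℝ) (Fin.snoc y ε) := by
    intro ε hε
    rw [qf_snoc_of_mem_gap hh hx y (i := ⟨j, by omega⟩) (i' := ⟨j + 1, hj⟩) rfl hm1 hm2
      (B := Real.exp (-|x ⟨j, by omega⟩ - m| / h)) rfl (by rw [hdist]) ε, hopp]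
    exact add_le_add_right (one_le_opposite_midpoint_increment (Real.exp_pos _)
      (exp_neg_abs_lt_one hh hm1.ne) hε) _
  exact hle.trans (le_min (hge 1 (by norm_num)) (hge (-1) (by norm_num)))
end
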